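/- Explicit lower bound on the local exclusion constant: for every α ∈ [0,1], min{ E^N_2(α), E^N_3(α), E^N_4(α) } ≥ min{ E^N_2(α), x₀ }, where x₀ := π² (877 − 96√69)/5329 is the positive root of (π + 4√x)² + (9/4)x = (9/4)π². -/

import Mathlib

noncomputable section

open MeasureTheory Real Set
open scoped BigOperators Topology

/-- The plane `ℝ²`, with points written as pairs. -/
abbrev Plane : Type := ℝ × ℝ

/-- Configuration space of `N` particles in the plane. -/
abbrev Config (N : ℕ) : Type := Fin N → Plane

/-- `x^{-⊥} := (-y, x)/(x² + y²)` for `x = (x, y) ∈ ℝ²`. -/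
def perpInv (v : Plane) : Plane :=
  (-v.2 / (v.1 ^ 2 + v.2 ^ 2), v.1 / (v.1 ^ 2 + v.2 ^ 2))

/-- The Aharonov–Bohm potential `A_j(x) = ∑_{k ≠ j} (x_j - x_k)^{-⊥}`. -/
def abPot (N : ℕ) (j : Fin N) (x : Config N) : Plane :=
  ∑ k ∈ Finset.univ.erase j, perpInv (x j - x k)

/-- Partial derivative of `Ψ` at `x` in direction `v` of the `j`-th particle. -/
def pder (N : ℕ) (j : Fin N) (v : Plane) (Ψ : Config N → ℂ) (x : Config N) : ℂ :=
  fderiv ℝ Ψ x (Pi.single j v)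

/-- The two components of `D_j Ψ = -i ∇_{x_j} Ψ + α A_j Ψ` at `x`. -/
def DOp (N : ℕ) (α : ℝ) (j : Fin N) (Ψ : Config N → ℂ) (x : Config N) : ℂ × ℂ :=
  (-Complex.I * pder N j (1, 0) Ψ x + Complex.ofReal (α * (abPot N j x).1) * Ψ x,
   -Complex.I * pder N j (0, 1) Ψ x + Complex.ofReal (α * (abPot N j x).2) * Ψ x)

/-- `|D_j Ψ(x)|²`, the squared Euclidean norm of the vector `D_j Ψ(x) ∈ ℂ²`. -/
def DSq (N : ℕ) (α : ℝ) (j : Fin N) (Ψ : Config N → ℂ) (x : Config N) : ℝ :=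
  ‖(DOp N α j Ψ x).1‖ ^ 2 + ‖(DOp N α j Ψ x).2‖ ^ 2

/-- The diagonal set `{x : x_j = x_k for some j ≠ k}`. -/
def diagSet (N : ℕ) : Set (Config N) := {x | ∃ j k : Fin N, j ≠ k ∧ x j = x k}

/-- Admissible wave functions: smooth, symmetric, vanishing on a neighbourhood of
the diagonal set. -/
structure Admissible (N : ℕ) (Ψ : Config N → ℂ) : Prop where
  smooth : ContDiff ℝ (⊤ : ℕ∞) Ψ
  symm : ∀ (σ : Equiv.Perm (Fin N)) (x : Config N), Ψ (x ∘ σ) = Ψ x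
  vanishes : ∃ U : Set (Config N), IsOpen U ∧ diagSet N ⊆ U ∧ ∀ x ∈ U, Ψ x = 0

/-- `Ω^N` as a subset of configuration space. -/
def cube (N : ℕ) (Ω : Set Plane) : Set (Config N) := Set.univ.pi fun _ => Ω

/-- Total kinetic energy `∑_j ∫_{Ω^N} |D_j Ψ|²`. -/
def kinE (N : ℕ) (α : ℝ) (Ω : Set Plane) (Ψ : Config N → ℂ) : ℝ :=
  ∑ j, ∫ x in cube N Ω, DSq N α j Ψ x

/-- `∫_{Ω^N} |Ψ|²`. -/
def normSq (N : ℕ) (Ω : Set Plane) (Ψ : Config N → ℂ) : ℝ :=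
  ∫ x in cube N Ω, ‖Ψ x‖ ^ 2

/-- Neumann ground-state energy of `N` anyons with statistics parameter `α` on `Ω`,
with the convention that it is `0` for `N = 0`. -/
def neumannE (N : ℕ) (α : ℝ) (Ω : Set Plane) : ℝ :=
  if N = 0 then 0 else
    sInf {E | ∃ Ψ : Config N → ℂ, Admissible N Ψ ∧ normSq N Ω Ψ = 1 ∧ E = kinE N α Ω Ψ}

/-- Dirichlet ground-state energy of `N` anyons with statistics parameter `α` on `Ω`. -/
def dirichletE (N : ℕ) (α : ℝ) (Ω : Set Plane) : ℝ :=
  sInf {E | ∃ Ψ : Config N → ℂ, Admissible N Ψ ∧ IsCompact (tsupport Ψ) ∧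
    tsupport Ψ ⊆ cube N Ω ∧ normSq N Ω Ψ = 1 ∧ E = kinE N α Ω Ψ}

/-- The open unit square `Q₀ = (0,1)²`. -/
def Q0 : Set Plane := Set.Ioo (0 : ℝ) 1 ×ˢ Set.Ioo (0 : ℝ) 1

/-- `E^N_N(α)`, the Neumann energy on the unit square. -/
def EN (N : ℕ) (α : ℝ) : ℝ := neumannE N α Q0

/-- `E^D_N(α)`, the Dirichlet energy on the unit square. -/
def ED (N : ℕ) (α : ℝ) : ℝ := dirichletE N α Q0

/-- One-particle density `ρ_Ψ` of a wave function of `n+1` particles. -/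
def density (n : ℕ) (Ψ : Config (n + 1) → ℂ) (y : Plane) : ℝ :=
  (n + 1) * ∫ z : Config n, ‖Ψ (Fin.cons y z)‖ ^ 2


/-- squared distance, as an extended nonnegative real -/
def dsq (a b : ℝ) : ENNReal := ENNReal.ofReal ((a - b) ^ 2)

lemma dsq_comm (a b : ℝ) : dsq a b = dsq b a := by
  unfold dsq; congr 1; ring

lemma measurable_dsq : Measurable (fun p : ℝ × ℝ => dsq p.1 p.2) := by
  unfold dsq; fun_prop

@[fun_prop]
lemma Measurable.dsq' {X : Type*} [MeasurableSpace X] {f g : X → ℝ} (hf : Measurable f)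
    (hg : Measurable g) : Measurable (fun x => dsq (f x) (g x)) :=
  measurable_dsq.comp (hf.prodMk hg)

lemma dsq_quad (a b c d : ℝ) :
    dsq a b + dsq c d ≤ (dsq a c + dsq d b) + (dsq a d + dsq c b) := by
  unfold dsq
  rw [← ENNReal.ofReal_add (by positivity) (by positivity),
    ← ENNReal.ofReal_add (by positivity) (by positivity),
    ← ENNReal.ofReal_add (by positivity) (by positivity),
    ← ENNReal.ofReal_add (by positivity) (by positivity)]
  apply ENNReal.ofReal_le_ofReal
  nlinarith [sq_nonneg (a + b - c - d)]

lemma tensor_two {X Y : Type*} [MeasurableSpace X] [MeasurableSpace Y] (μ : Measure X)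
    (ν : Measure Y) [IsProbabilityMeasure μ] [IsProbabilityMeasure ν] (f : X × Y → ℝ)
    (hf : Measurable f) :
    ∫⁻ p, ∫⁻ q, dsq (f p) (f q) ∂(μ.prod ν) ∂(μ.prod ν) ≤
      (∫⁻ x, ∫⁻ y, ∫⁻ y', dsq (f (x, y)) (f (x, y')) ∂ν ∂ν ∂μ) +
      (∫⁻ y, ∫⁻ x, ∫⁻ x', dsq (f (x, y)) (f (x', y)) ∂μ ∂μ ∂ν) := by
  set I : (X → X → Y → Y → ENNReal) → ENNReal := fun h =>
    ∫⁻ x, ∫⁻ x', ∫⁻ y, ∫⁻ y', h x x' y y' ∂ν ∂ν ∂μ ∂μ with hI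
  have hL : ∫⁻ p, ∫⁻ q, dsq (f p) (f q) ∂(μ.prod ν) ∂(μ.prod ν) =
      I fun x x' y y' => dsq (f (x, y)) (f (x', y')) := by
    rw [lintegral_prod _ (by fun_prop)]
    simp only [hI]
    congr 1; ext x
    have : ∀ y, ∫⁻ q, dsq (f (x, y)) (f q) ∂(μ.prod ν) =
        ∫⁻ x', ∫⁻ y', dsq (f (x, y)) (f (x', y')) ∂ν ∂μ := fun y =>
      lintegral_prod _ (by fun_prop)
    simp_rw [this]
    rw [lintegral_lintegral_swap]
    fun_prop
  have hL2 : I (fun x x' y y' => dsq (f (x, y)) (f (x', y'))) =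
      I fun x x' y y' => dsq (f (x, y')) (f (x', y)) := by
    simp only [hI]
    congr 1; ext x; congr 1; ext x'
    rw [lintegral_lintegral_swap]
    fun_prop
  have h1 : (∫⁻ x, ∫⁻ y, ∫⁻ y', dsq (f (x, y)) (f (x, y')) ∂ν ∂ν ∂μ) =
      I fun x x' y y' => dsq (f (x, y)) (f (x, y')) := by
    simp [hI]
  have h1' : (∫⁻ x, ∫⁻ y, ∫⁻ y', dsq (f (x, y)) (f (x, y')) ∂ν ∂ν ∂μ) =
      I fun x x' y y' => dsq (f (x', y)) (f (x', y')) := by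
    simp [hI]
  have h2 : (∫⁻ y, ∫⁻ x, ∫⁻ x', dsq (f (x, y)) (f (x', y)) ∂μ ∂μ ∂ν) =
      I fun x x' y y' => dsq (f (x, y)) (f (x', y)) := by
    simp only [hI, lintegral_const, measure_univ, mul_one]
    rw [lintegral_lintegral_swap (by fun_prop)]
    congr 1; ext x
    rw [lintegral_lintegral_swap]
    fun_prop
  have h2' : (∫⁻ y, ∫⁻ x, ∫⁻ x', dsq (f (x, y)) (f (x', y)) ∂μ ∂μ ∂ν) =
      I fun x x' y y' => dsq (f (x, y')) (f (x', y')) := by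
    rw [h2]; simp [hI]
  have add : ∀ g h : X → X → Y → Y → ENNReal,
      Measurable (fun p : X × X × Y × Y => g p.1 p.2.1 p.2.2.1 p.2.2.2) →
      I g + I h = I fun x x' y y' => g x x' y y' + h x x' y y' := by
    intro g h hg
    simp only [hI]
    rw [← lintegral_add_left]
    · congr 1; ext x
      rw [← lintegral_add_left]
      · congr 1; ext x'
        rw [← lintegral_add_left]
        · congr 1; ext y
          rw [← lintegral_add_left]
          exact hg.comp (g := fun p : X × X × Y × Y => g p.1 p.2.1 p.2.2.1 p.2.2.2)
            (f := fun y' => (x, x', y, y')) (by fun_prop)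
        · apply Measurable.lintegral_prod_right' (f := fun p : Y × Y => g x x' p.1 p.2)
          exact hg.comp (f := fun p : Y × Y => (x, x', p.1, p.2)) (by fun_prop)
      · apply Measurable.lintegral_prod_right'
          (f := fun p : X × Y => ∫⁻ y', g x p.1 p.2 y' ∂ν)
        apply Measurable.lintegral_prod_right' (f := fun p : (X × Y) × Y => g x p.1.1 p.1.2 p.2)
        exact hg.comp (f := fun p : (X × Y) × Y => (x, p.1.1, p.1.2, p.2)) (by fun_prop)
    · apply Measurable.lintegral_prod_right'
          (f := fun p : X × X => ∫⁻ y, ∫⁻ y', g p.1 p.2 y y' ∂ν ∂ν)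
      apply Measurable.lintegral_prod_right'
          (f := fun p : (X × X) × Y => ∫⁻ y', g p.1.1 p.1.2 p.2 y' ∂ν)
      apply Measurable.lintegral_prod_right'
        (f := fun p : ((X × X) × Y) × Y => g p.1.1.1 p.1.1.2 p.1.2 p.2)
      exact hg.comp (f := fun p : ((X × X) × Y) × Y => (p.1.1.1, p.1.1.2, p.1.2, p.2))
        (by fun_prop)
  have mono : ∀ g h : X → X → Y → Y → ENNReal, (∀ x x' y y', g x x' y y' ≤ h x x' y y') →
      I g ≤ I h := fun g h H =>
    lintegral_mono fun x => lintegral_mono fun x' => lintegral_mono fun y =>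
      lintegral_mono fun y' => H x x' y y'
  rw [hL]
  set L := I fun x x' y y' => dsq (f (x, y)) (f (x', y')) with hLL
  set A := (∫⁻ x, ∫⁻ y, ∫⁻ y', dsq (f (x, y)) (f (x, y')) ∂ν ∂ν ∂μ) with hA
  set B := (∫⁻ y, ∫⁻ x, ∫⁻ x', dsq (f (x, y)) (f (x', y)) ∂μ ∂μ ∂ν) with hB
  have key : L + L ≤ (A + A) + (B + B) := by
    refine (congrArg₂ (· + ·) hLL hL2).le.trans (le_trans ?_
      (congrArg₂ (· + ·) (congrArg₂ (· + ·) h1 h1') (congrArg₂ (· + ·) h2 h2')).ge)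
    rw [add _ _ (by fun_prop), add _ _ (by fun_prop), add _ _ (by fun_prop),
      add _ _ (by fun_prop)]
    exact mono _ _ fun x x' y y' => dsq_quad _ _ _ _
  have : (2 : ENNReal) * L ≤ 2 * (A + B) := by
    calc 2 * L = L + L := two_mul _
      _ ≤ _ := key
      _ = _ := by ring
  exact (ENNReal.mul_le_mul_iff_right (by simp) (by simp)).1 this

lemma ftc_cs (w w' : ℝ → ℝ) (hw : ∀ t, HasDerivAt w (w' t) t) (hc : Continuous w')
    {s t : ℝ} (hs : 0 ≤ s) (hst : s < t) (ht : t ≤ 1) :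
    (w s - w t) ^ 2 ≤ (t - s) * ∫ r in (0 : ℝ)..1, (w' r) ^ 2 := by
  have h1 : ∫ r in s..t, w' r = w t - w s :=
    intervalIntegral.integral_eq_sub_of_hasDerivAt (fun x _ => hw x) (hc.intervalIntegrable _ _)
  have hpos : 0 < t - s := by linarith
  set c := (w t - w s) / (t - s) with hcdef
  have h2 : 0 ≤ ∫ r in s..t, (w' r - c) ^ 2 :=
    intervalIntegral.integral_nonneg hst.le fun _ _ => sq_nonneg _
  have h3 : ∫ r in s..t, (w' r - c) ^ 2 =
      (∫ r in s..t, (w' r) ^ 2) - 2 * c * (w t - w s) + c ^ 2 * (t - s) := by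
    have : ∀ r, (w' r - c) ^ 2 = (w' r) ^ 2 - (2 * c) * w' r + c ^ 2 := fun r => by ring
    simp_rw [this]
    rw [intervalIntegral.integral_add, intervalIntegral.integral_sub,
      intervalIntegral.integral_const_mul, h1, intervalIntegral.integral_const, smul_eq_mul]
    · ring
    all_goals exact Continuous.intervalIntegrable (by fun_prop) _ _
  have h4 : ∫ r in s..t, (w' r) ^ 2 ≤ ∫ r in (0 : ℝ)..1, (w' r) ^ 2 :=
    intervalIntegral.integral_mono_interval hs hst.le ht
      (Filter.Eventually.of_forall fun _ => sq_nonneg _)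
      (Continuous.intervalIntegrable (by fun_prop) _ _)
  have h5 : c * (t - s) = w t - w s := by rw [hcdef]; field_simp
  have h6 : c * (w t - w s) ≤ ∫ r in (0 : ℝ)..1, (w' r) ^ 2 := by
    have : c ^ 2 * (t - s) = c * (w t - w s) := by rw [← h5]; ring
    linarith
  calc (w s - w t) ^ 2 = (t - s) * (c * (w t - w s)) := by
        rw [← mul_assoc, mul_comm (t - s) c, h5]; ring
    _ ≤ _ := by gcongr

lemma ftc_cs' (w w' : ℝ → ℝ) (hw : ∀ t, HasDerivAt w (w' t) t) (hc : Continuous w')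
    {s t : ℝ} (hs : s ∈ Ioo (0 : ℝ) 1) (ht : t ∈ Ioo (0 : ℝ) 1) :
    (w s - w t) ^ 2 ≤ ((s - t) ^ 2 + 1 / 4) * ∫ r in (0 : ℝ)..1, (w' r) ^ 2 := by
  have hK : 0 ≤ ∫ r in (0 : ℝ)..1, (w' r) ^ 2 :=
    intervalIntegral.integral_nonneg zero_le_one fun _ _ => sq_nonneg _
  rcases lt_trichotomy s t with h | h | h
  · refine (ftc_cs w w' hw hc hs.1.le h ht.2.le).trans ?_
    gcongr; nlinarith [sq_nonneg (t - s - 1 / 2)]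
  · subst h; simp; positivity
  · have := ftc_cs w w' hw hc ht.1.le h hs.2.le
    rw [show (w s - w t) ^ 2 = (w t - w s) ^ 2 by ring]
    refine this.trans ?_
    gcongr; nlinarith [sq_nonneg (s - t - 1 / 2)]

lemma lintegral_Ioo_ofReal {f : ℝ → ℝ} (hf : Continuous f) (h0 : ∀ t, 0 ≤ f t) :
    ∫⁻ t in Ioo (0 : ℝ) 1, ENNReal.ofReal (f t) = ENNReal.ofReal (∫ t in (0 : ℝ)..1, f t) := by
  rw [intervalIntegral.integral_of_le zero_le_one, ← integral_Ioc_eq_integral_Ioo.symm,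
    ofReal_integral_eq_lintegral_ofReal]
  · exact (hf.integrableOn_Icc (a := 0) (b := 1)).mono_set Ioo_subset_Icc_self
  · exact Filter.Eventually.of_forall h0

lemma poinc_one (w w' : ℝ → ℝ) (hw : ∀ t, HasDerivAt w (w' t) t) (hc : Continuous w') :
    ∫⁻ s in Ioo (0 : ℝ) 1, ∫⁻ t in Ioo (0 : ℝ) 1, dsq (w s) (w t) ≤
      ENNReal.ofReal (5 / 12) * ∫⁻ t in Ioo (0 : ℝ) 1, ENNReal.ofReal ((w' t) ^ 2) := by
  rw [lintegral_Ioo_ofReal (by fun_prop) (fun t => sq_nonneg _)]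
  set K := ∫ r in (0 : ℝ)..1, (w' r) ^ 2 with hKdef
  have hK : 0 ≤ K := intervalIntegral.integral_nonneg zero_le_one fun _ _ => sq_nonneg _
  calc _ ≤ ∫⁻ s in Ioo (0 : ℝ) 1, ∫⁻ t in Ioo (0 : ℝ) 1,
        ENNReal.ofReal (((s - t) ^ 2 + 1 / 4) * K) := by
        refine setLIntegral_mono' measurableSet_Ioo fun s hs => ?_
        refine setLIntegral_mono' measurableSet_Ioo fun t ht => ?_
        exact ENNReal.ofReal_le_ofReal (ftc_cs' w w' hw hc hs ht)
    _ = ∫⁻ s in Ioo (0 : ℝ) 1, ENNReal.ofReal ((s ^ 2 - s + 7 / 12) * K) := by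
        congr 1; ext s
        rw [lintegral_Ioo_ofReal (by fun_prop) (fun t => by positivity)]
        congr 1
        rw [intervalIntegral.integral_mul_const]
        congr 1
        have : ∀ t : ℝ, (s - t) ^ 2 + 1 / 4 = (s ^ 2 + 1 / 4) - (2 * s) * t + t ^ 2 :=
          fun t => by ring
        simp_rw [this]
        rw [intervalIntegral.integral_add, intervalIntegral.integral_sub,
          intervalIntegral.integral_const_mul, integral_id, integral_pow,
          intervalIntegral.integral_const]
        · norm_num; ring
        all_goals exact Continuous.intervalIntegrable (by fun_prop) _ _
    _ = ENNReal.ofReal (5 / 12 * K) := by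
        rw [lintegral_Ioo_ofReal (by fun_prop)
          (fun t => mul_nonneg (by nlinarith [sq_nonneg (t - 1 / 2)]) hK)]
        congr 1
        rw [intervalIntegral.integral_mul_const]
        congr 1
        rw [intervalIntegral.integral_add, intervalIntegral.integral_sub, integral_id,
          integral_pow, intervalIntegral.integral_const]
        · norm_num
        all_goals exact Continuous.intervalIntegrable (by fun_prop) _ _
    _ = _ := ENNReal.ofReal_mul (by norm_num)

lemma restrict_Q0 : (volume : Measure Plane).restrict Q0 =
    (volume.restrict (Ioo (0 : ℝ) 1)).prod (volume.restrict (Ioo (0 : ℝ) 1)) := by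
  rw [Measure.prod_restrict, ← Measure.volume_eq_prod]; rfl

instance : IsProbabilityMeasure (volume.restrict (Ioo (0 : ℝ) 1)) := ⟨by simp⟩

instance : IsProbabilityMeasure ((volume : Measure Plane).restrict Q0) := by
  rw [restrict_Q0]; infer_instance

/-- squared gradient of a function on the plane -/
def gradSq (g : Plane → ℝ) (p : Plane) : ℝ :=
  (fderiv ℝ g p (1, 0)) ^ 2 + (fderiv ℝ g p (0, 1)) ^ 2

lemma poinc_plane (g : Plane → ℝ) (hg : ContDiff ℝ 1 g) :
    ∫⁻ p in Q0, ∫⁻ q in Q0, dsq (g p) (g q) ≤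
      ENNReal.ofReal (5 / 12) * ∫⁻ p in Q0, ENNReal.ofReal (gradSq g p) := by
  have hd := hg.differentiable one_ne_zero
  have hcf : Continuous (fderiv ℝ g) := hg.continuous_fderiv one_ne_zero
  have hc1 : Continuous fun p : Plane => fderiv ℝ g p (1, 0) := hcf.clm_apply continuous_const
  have hc2 : Continuous fun p : Plane => fderiv ℝ g p (0, 1) := hcf.clm_apply continuous_const
  rw [restrict_Q0]
  refine (tensor_two _ _ g hg.continuous.measurable).trans ?_
  have e : ∫⁻ p, ENNReal.ofReal (gradSq g p) ∂((volume.restrict (Ioo (0 : ℝ) 1)).prod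
      (volume.restrict (Ioo (0 : ℝ) 1))) =
      (∫⁻ x in Ioo (0 : ℝ) 1, ∫⁻ y in Ioo (0 : ℝ) 1,
        ENNReal.ofReal ((fderiv ℝ g (x, y) (0, 1)) ^ 2)) +
      (∫⁻ y in Ioo (0 : ℝ) 1, ∫⁻ x in Ioo (0 : ℝ) 1,
        ENNReal.ofReal ((fderiv ℝ g (x, y) (1, 0)) ^ 2)) := by
    unfold gradSq
    simp_rw [fun p : Plane => ENNReal.ofReal_add (sq_nonneg (fderiv ℝ g p (1, 0)))
      (sq_nonneg (fderiv ℝ g p (0, 1)))]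
    rw [lintegral_add_left (by fun_prop), add_comm, lintegral_prod _ (by fun_prop),
      lintegral_prod_symm _ (by fun_prop)]
  rw [e, mul_add, ← lintegral_const_mul _ (by fun_prop), ← lintegral_const_mul _ (by fun_prop)]
  refine add_le_add (lintegral_mono fun x => ?_) (lintegral_mono fun y => ?_)
  · refine poinc_one (fun y => g (x, y)) (fun y => fderiv ℝ g (x, y) (0, 1)) (fun t => ?_)
      (by fun_prop)
    have h := (hd (x, t)).hasFDerivAt.comp_hasDerivAt t
      ((hasDerivAt_const t x).prodMk (hasDerivAt_id t))
    exact h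
  · refine poinc_one (fun x => g (x, y)) (fun x => fderiv ℝ g (x, y) (1, 0)) (fun t => ?_)
      (by fun_prop)
    have h := (hd (t, y)).hasFDerivAt.comp_hasDerivAt t
      ((hasDerivAt_id t).prodMk (hasDerivAt_const t y))
    exact h

lemma restrict_cube (n : ℕ) : (volume : Measure (Config n)).restrict (cube n Q0) =
    Measure.pi fun _ => (volume : Measure Plane).restrict Q0 := by
  unfold cube
  rw [volume_pi, Measure.restrict_pi_pi]

instance (n : ℕ) : IsProbabilityMeasure ((volume : Measure (Config n)).restrict (cube n Q0)) := by
  rw [restrict_cube]; infer_instance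

/-- squared gradient of a function in the `i`-th particle -/
def rgrad (n : ℕ) (i : Fin n) (f : Config n → ℝ) (x : Config n) : ℝ :=
  (fderiv ℝ f x (Pi.single i (1, 0))) ^ 2 + (fderiv ℝ f x (Pi.single i (0, 1))) ^ 2

lemma continuous_rgrad (n : ℕ) (i : Fin n) (f : Config n → ℝ) (hf : ContDiff ℝ 1 f) :
    Continuous (rgrad n i f) := by
  have hcf : Continuous (fderiv ℝ f) := hf.continuous_fderiv one_ne_zero
  unfold rgrad
  exact ((hcf.clm_apply continuous_const).pow 2).add ((hcf.clm_apply continuous_const).pow 2)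

lemma mp_cons (n : ℕ) : MeasurePreserving
    (fun p : Plane × Config n => (Fin.cons p.1 p.2 : Config (n + 1)))
    (((volume : Measure Plane).restrict Q0).prod
      ((volume : Measure (Config n)).restrict (cube n Q0)))
    ((volume : Measure (Config (n + 1))).restrict (cube (n + 1) Q0)) := by
  rw [restrict_cube, restrict_cube]
  have := (measurePreserving_piFinSuccAbove
    (fun _ : Fin (n + 1) => (volume : Measure Plane).restrict Q0) 0).symm
  have e : (fun p : Plane × Config n => (Fin.cons p.1 p.2 : Config (n + 1))) =
      (MeasurableEquiv.piFinSuccAbove (fun _ : Fin (n + 1) => Plane) 0).symm := by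
    funext p
    exact (Fin.insertNth_zero' p.1 p.2).symm
  rw [e]
  exact this

/-- linear embedding in the tail -/
def tailL (n : ℕ) : Config n →L[ℝ] Config (n + 1) :=
  ContinuousLinearMap.pi fun i => Fin.cases 0 (fun k => ContinuousLinearMap.proj k) i

lemma hasFDerivAt_tail (n : ℕ) (p : Plane) (z : Config n) :
    HasFDerivAt (fun z : Config n => (Fin.cons p z : Config (n + 1))) (tailL n) z := by
  rw [hasFDerivAt_pi']
  intro i
  refine Fin.cases ?_ (fun k => ?_) i
  · exact hasFDerivAt_const p z
  · exact (ContinuousLinearMap.proj (R := ℝ) (φ := fun _ : Fin n => Plane) k).hasFDerivAt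

lemma hasFDerivAt_head (n : ℕ) (p : Plane) (z : Config n) :
    HasFDerivAt (fun p : Plane => (Fin.cons p z : Config (n + 1)))
      (ContinuousLinearMap.single ℝ (fun _ : Fin (n + 1) => Plane) 0) p := by
  rw [hasFDerivAt_pi']
  intro i
  refine Fin.cases ?_ (fun k => ?_) i
  · exact hasFDerivAt_id p
  · have e : (ContinuousLinearMap.proj (R := ℝ) (φ := fun _ : Fin (n + 1) => Plane) k.succ).comp
        (ContinuousLinearMap.single ℝ (fun _ : Fin (n + 1) => Plane) 0) = 0 := by
      ext <;> simp
    rw [e]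
    exact hasFDerivAt_const (z k) p

lemma contDiff_tail (n : ℕ) (p : Plane) :
    ContDiff ℝ 1 (fun z : Config n => (Fin.cons p z : Config (n + 1))) := by
  rw [contDiff_pi]
  intro i
  refine Fin.cases ?_ (fun k => ?_) i
  · exact contDiff_const
  · exact contDiff_apply ℝ Plane k

lemma contDiff_head (n : ℕ) (z : Config n) :
    ContDiff ℝ 1 (fun p : Plane => (Fin.cons p z : Config (n + 1))) := by
  rw [contDiff_pi]
  intro i
  refine Fin.cases ?_ (fun k => ?_) i
  · exact contDiff_id
  · exact contDiff_const

lemma tailL_single (n : ℕ) (i : Fin n) (v : Plane) :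
    tailL n (Pi.single i v) = Pi.single i.succ v := by
  funext k
  refine Fin.cases ?_ (fun k => ?_) k
  · simp [tailL, Pi.single_apply, (Fin.succ_ne_zero i).symm]
  · simp [tailL, Pi.single_apply]

lemma poinc_config (n : ℕ) (f : Config n → ℝ) (hf : ContDiff ℝ 1 f) :
    ∫⁻ x in cube n Q0, ∫⁻ y in cube n Q0, dsq (f x) (f y) ≤
      ENNReal.ofReal (5 / 12) * ∑ i, ∫⁻ x in cube n Q0, ENNReal.ofReal (rgrad n i f x) := by
  induction n with
  | zero =>
    have : ∀ x y, dsq (f x) (f y) = 0 := fun x y => by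
      rw [Subsingleton.elim x y]; simp [dsq]
    simp [this]
  | succ n ih =>
    have hfm := hf.continuous.measurable
    have hd := hf.differentiable one_ne_zero
    have hcons : Continuous fun p : Plane × Config n => (Fin.cons p.1 p.2 : Config (n + 1)) := by
      refine continuous_pi fun i => ?_
      refine Fin.cases ?_ (fun k => ?_) i
      · exact continuous_fst
      · exact (continuous_apply k).comp continuous_snd
    have hG : ∀ i, Measurable fun p : Plane × Config n =>
        ENNReal.ofReal (rgrad (n + 1) i f (Fin.cons p.1 p.2)) := fun i =>
      (((continuous_rgrad _ i f hf).comp hcons).measurable).ennreal_ofReal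
    have hfc : Measurable fun p : Plane × Config n => f (Fin.cons p.1 p.2) :=
      (hf.continuous.comp hcons).measurable
    have hr : ∀ i, ∫⁻ x in cube (n + 1) Q0, ENNReal.ofReal (rgrad (n + 1) i f x) =
        ∫⁻ p, ENNReal.ofReal (rgrad (n + 1) i f (Fin.cons p.1 p.2))
          ∂(((volume : Measure Plane).restrict Q0).prod
      ((volume : Measure (Config n)).restrict (cube n Q0))) := fun i =>
      ((mp_cons n).lintegral_comp ((continuous_rgrad _ i f hf).measurable.ennreal_ofReal)).symm
    have hl : ∫⁻ x in cube (n + 1) Q0, ∫⁻ y in cube (n + 1) Q0, dsq (f x) (f y) =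
        ∫⁻ p, ∫⁻ q, dsq (f (Fin.cons p.1 p.2)) (f (Fin.cons q.1 q.2))
          ∂(((volume : Measure Plane).restrict Q0).prod
      ((volume : Measure (Config n)).restrict (cube n Q0)))
          ∂(((volume : Measure Plane).restrict Q0).prod
      ((volume : Measure (Config n)).restrict (cube n Q0))) := by
      rw [← (mp_cons n).lintegral_comp (by fun_prop)]
      congr 1; ext p
      rw [← (mp_cons n).lintegral_comp (by fun_prop)]
    rw [hl]
    refine (tensor_two _ _ (fun p : Plane × Config n => f (Fin.cons p.1 p.2)) hfc).trans ?_
    rw [Fin.sum_univ_succ, mul_add, add_comm]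
    refine add_le_add ?_ ?_
    · rw [hr, lintegral_prod_symm _ (hG 0).aemeasurable,
        ← lintegral_const_mul _ (hG 0).lintegral_prod_left']
      refine lintegral_mono fun z => ?_
      refine (poinc_plane (fun p => f (Fin.cons p z)) (hf.comp (contDiff_head n z))).trans_eq ?_
      congr 2; ext p; congr 1
      have h := (hd (Fin.cons p z)).hasFDerivAt.comp p (hasFDerivAt_head n p z)
      have h' : fderiv ℝ (fun p => f (Fin.cons p z)) p = _ := h.fderiv
      unfold gradSq rgrad
      rw [h']; simp
    · simp_rw [hr, lintegral_prod _ (hG _).aemeasurable]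
      rw [← lintegral_finsetSum _ (fun i _ => (hG _).lintegral_prod_right'),
        ← lintegral_const_mul _ (Finset.measurable_sum _ fun i _ => (hG _).lintegral_prod_right')]
      refine lintegral_mono fun p => ?_
      refine (ih (fun z => f (Fin.cons p z)) (hf.comp (contDiff_tail n p))).trans_eq ?_
      congr 1; refine Finset.sum_congr rfl fun i _ => ?_
      congr 1; ext z; congr 1
      have h := (hd (Fin.cons p z)).hasFDerivAt.comp z (hasFDerivAt_tail n p z)
      have h' : fderiv ℝ (fun z => f (Fin.cons p z)) z = _ := h.fderiv
      unfold rgrad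
      rw [h']; simp [tailL_single]

lemma integrableOn_cube {n : ℕ} {f : Config n → ℝ} (hf : Continuous f) :
    IntegrableOn f (cube n Q0) := by
  have hK : IsCompact (Set.univ.pi fun _ : Fin n => (Icc (0 : ℝ) 1 ×ˢ Icc (0 : ℝ) 1)) :=
    isCompact_univ_pi fun _ => isCompact_Icc.prod isCompact_Icc
  refine (hf.continuousOn.integrableOn_compact hK).mono_set ?_
  exact Set.pi_mono fun _ _ => Set.prod_mono Ioo_subset_Icc_self Ioo_subset_Icc_self

lemma lintegral_cube {n : ℕ} {f : Config n → ℝ} (hf : Continuous f) (h0 : ∀ x, 0 ≤ f x) :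
    ∫⁻ x in cube n Q0, ENNReal.ofReal (f x) = ENNReal.ofReal (∫ x in cube n Q0, f x) :=
  (ofReal_integral_eq_lintegral_ofReal (integrableOn_cube hf)
    (Filter.Eventually.of_forall h0)).symm

lemma DSq_nonneg (N : ℕ) (α : ℝ) (j : Fin N) (Ψ : Config N → ℂ) (x : Config N) :
    0 ≤ DSq N α j Ψ x := by unfold DSq; positivity

lemma perpInv_den_ne {v : Plane} (hv : v ≠ 0) : v.1 ^ 2 + v.2 ^ 2 ≠ 0 := by
  intro h
  apply hv
  have h1 : v.1 = 0 := by nlinarith [sq_nonneg v.1, sq_nonneg v.2]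
  have h2 : v.2 = 0 := by nlinarith [sq_nonneg v.1, sq_nonneg v.2]
  exact Prod.ext h1 h2

lemma continuousAt_perpInv {v : Plane} (hv : v ≠ 0) : ContinuousAt perpInv v := by
  have := perpInv_den_ne hv
  have h1 : ContinuousAt (fun v : Plane => -v.2 / (v.1 ^ 2 + v.2 ^ 2)) v :=
    ContinuousAt.div (by fun_prop) (by fun_prop) this
  have h2 : ContinuousAt (fun v : Plane => v.1 / (v.1 ^ 2 + v.2 ^ 2)) v :=
    ContinuousAt.div (by fun_prop) (by fun_prop) this
  exact h1.prodMk h2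

lemma continuous_DSq {N : ℕ} (α : ℝ) (j : Fin N) {Ψ : Config N → ℂ} (h : Admissible N Ψ) :
    Continuous (DSq N α j Ψ) := by
  obtain ⟨U, hU, hdU, hz⟩ := h.vanishes
  rw [continuous_iff_continuousAt]
  intro x
  by_cases hx : x ∈ diagSet N
  · have hxU := hdU hx
    have hev : DSq N α j Ψ =ᶠ[𝓝 x] fun _ => 0 := by
      filter_upwards [hU.mem_nhds hxU] with y hy
      have hΨ : Ψ =ᶠ[𝓝 y] fun _ => 0 := by
        filter_upwards [hU.mem_nhds hy] with z hz' using hz z hz'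
      have hf : fderiv ℝ Ψ y = 0 := by rw [hΨ.fderiv_eq]; simp
      simp [DSq, DOp, pder, hf, hz y hy]
    exact continuousAt_const.congr hev.symm
  · have hA : ContinuousAt (abPot N j) x := by
      unfold abPot
      refine tendsto_finsetSum _ fun k hk => ?_
      have hne : x j - x k ≠ 0 := fun h0 =>
        hx ⟨j, k, (Finset.ne_of_mem_erase hk).symm, sub_eq_zero.1 h0⟩
      exact ContinuousAt.comp (f := fun x : Config N => x j - x k) (continuousAt_perpInv hne)
        (by fun_prop)
    have hcf : Continuous (fderiv ℝ Ψ) := h.smooth.continuous_fderiv (by simp)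
    have hp : ∀ v, Continuous (pder N j v Ψ) := fun v => hcf.clm_apply continuous_const
    have hΨ := h.smooth.continuous
    unfold DSq DOp
    have h1 : ContinuousAt (fun x => ((α * (abPot N j x).1 : ℝ) : ℂ)) x :=
      Complex.continuous_ofReal.continuousAt.comp (continuousAt_const.mul hA.fst)
    have h2 : ContinuousAt (fun x => ((α * (abPot N j x).2 : ℝ) : ℂ)) x :=
      Complex.continuous_ofReal.continuousAt.comp (continuousAt_const.mul hA.snd)
    have := (hp (1, 0)).continuousAt (x := x)
    have := (hp (0, 1)).continuousAt (x := x)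
    have := hΨ.continuousAt (x := x)
    fun_prop

/-- regularised modulus -/
def regMod {N : ℕ} (ε : ℝ) (Ψ : Config N → ℂ) (x : Config N) : ℝ := √(‖Ψ x‖ ^ 2 + ε)

lemma contDiff_regMod {N : ℕ} {ε : ℝ} (hε : 0 < ε) {Ψ : Config N → ℂ}
    (h : ContDiff ℝ (⊤ : ℕ∞) Ψ) : ContDiff ℝ 1 (regMod ε Ψ) := by
  have h1 : ContDiff ℝ 1 Ψ := h.of_le (by exact_mod_cast le_top)
  unfold regMod
  exact ((h1.norm_sq ℝ).add contDiff_const).sqrt fun x => by positivity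

lemma diamag_dir {N : ℕ} {ε : ℝ} (hε : 0 < ε) {Ψ : Config N → ℂ}
    (h : ContDiff ℝ (⊤ : ℕ∞) Ψ) (x v : Config N) (a : ℝ) :
    (fderiv ℝ (regMod ε Ψ) x v) ^ 2 ≤
      ‖-Complex.I * fderiv ℝ Ψ x v + Complex.ofReal a * Ψ x‖ ^ 2 := by
  have hd : HasFDerivAt Ψ (fderiv ℝ Ψ x) x := (h.differentiable (by simp) x).hasFDerivAt
  have hpos : 0 < ‖Ψ x‖ ^ 2 + ε := by positivity
  have h1 := (hd.norm_sq.add_const ε).sqrt hpos.ne'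
  have h2 : fderiv ℝ (regMod ε Ψ) x = _ := h1.fderiv
  rw [h2]
  set d := fderiv ℝ Ψ x v with hddef
  set D := -Complex.I * d + Complex.ofReal a * Ψ x with hD
  set s := √(‖Ψ x‖ ^ 2 + ε) with hs
  have hs0 : 0 < s := Real.sqrt_pos.2 hpos
  have hs2 : s ^ 2 = ‖Ψ x‖ ^ 2 + ε := Real.sq_sqrt hpos.le
  have e1 : inner ℝ (Ψ x) d = -((starRingEnd ℂ) (Ψ x) * D).im := by
    rw [Complex.inner, hD]
    simp [Complex.mul_re, Complex.mul_im]
    ring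
  have e2 : |inner ℝ (Ψ x) d| ≤ ‖Ψ x‖ * ‖D‖ := by
    rw [e1, abs_neg]
    refine (Complex.abs_im_le_norm _).trans ?_
    simp
  have e3 : (inner ℝ (Ψ x) d) ^ 2 ≤ s ^ 2 * ‖D‖ ^ 2 := by
    rw [← sq_abs]
    calc |inner ℝ (Ψ x) d| ^ 2 ≤ (‖Ψ x‖ * ‖D‖) ^ 2 := by gcongr
      _ = ‖Ψ x‖ ^ 2 * ‖D‖ ^ 2 := by ring
      _ ≤ s ^ 2 * ‖D‖ ^ 2 := mul_le_mul_of_nonneg_right (by linarith) (by positivity)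
  simp only [smul_apply, ContinuousLinearMap.comp_apply, smul_eq_mul,
    innerSL_apply_apply, ← hddef, nsmul_eq_mul]
  calc _ = (inner ℝ (Ψ x) d) ^ 2 / s ^ 2 := by
        push_cast; field_simp
    _ ≤ ‖D‖ ^ 2 := by
        rw [div_le_iff₀ (by positivity)]; linarith

lemma diamag {N : ℕ} (α : ℝ) {ε : ℝ} (hε : 0 < ε) {Ψ : Config N → ℂ}
    (h : ContDiff ℝ (⊤ : ℕ∞) Ψ) (i : Fin N) (x : Config N) :
    rgrad N i (regMod ε Ψ) x ≤ DSq N α i Ψ x := by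
  unfold rgrad DSq DOp pder
  exact add_le_add (diamag_dir hε h x _ _) (diamag_dir hε h x _ _)

lemma lintegral_dsq {n : ℕ} (u : Config n → ℝ) (hu : Continuous u) :
    ∫⁻ x in cube n Q0, ∫⁻ y in cube n Q0, dsq (u x) (u y) =
      ENNReal.ofReal (2 * ((∫ x in cube n Q0, u x ^ 2) - (∫ x in cube n Q0, u x) ^ 2)) := by
  set m := ∫ x in cube n Q0, u x with hm
  set S := ∫ x in cube n Q0, u x ^ 2 with hS
  have hi : ∀ x, ∫ y in cube n Q0, (u x - u y) ^ 2 = u x ^ 2 - 2 * u x * m + S := by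
    intro x
    have : ∀ y, (u x - u y) ^ 2 = u x ^ 2 - (2 * u x) * u y + u y ^ 2 := fun y => by ring
    simp_rw [this]
    rw [integral_add, integral_sub, integral_const_mul, integral_const]
    · simp [hm, hS]
    all_goals exact integrableOn_cube (by fun_prop)
  have : ∀ x, ∫⁻ y in cube n Q0, dsq (u x) (u y) =
      ENNReal.ofReal (u x ^ 2 - 2 * u x * m + S) := by
    intro x
    unfold dsq
    rw [lintegral_cube (by fun_prop) (fun _ => sq_nonneg _), hi]
  simp_rw [this]
  rw [lintegral_cube (by fun_prop)]
  · congr 1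
    rw [integral_add, integral_sub, integral_mul_const, integral_const_mul, integral_const]
    · simp [← hm, ← hS]; ring
    all_goals exact integrableOn_cube (by fun_prop)
  · intro x
    rw [← hi]
    exact integral_nonneg fun _ => sq_nonneg _

lemma var_bound {N : ℕ} (α : ℝ) {ε : ℝ} (hε : 0 < ε) {Ψ : Config N → ℂ}
    (h : Admissible N Ψ) :
    (∫ x in cube N Q0, regMod ε Ψ x ^ 2) - (∫ x in cube N Q0, regMod ε Ψ x) ^ 2 ≤
      5 / 24 * kinE N α Q0 Ψ := by
  have hu := contDiff_regMod hε h.smooth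
  have h1 := poinc_config N _ hu
  rw [lintegral_dsq _ hu.continuous] at h1
  have h2 : ∑ i, ∫⁻ x in cube N Q0, ENNReal.ofReal (rgrad N i (regMod ε Ψ) x) ≤
      ENNReal.ofReal (kinE N α Q0 Ψ) := by
    unfold kinE
    rw [ENNReal.ofReal_sum_of_nonneg fun i _ => integral_nonneg fun x => DSq_nonneg _ _ _ _ _]
    refine Finset.sum_le_sum fun i _ => ?_
    rw [← lintegral_cube (continuous_DSq α i h) (DSq_nonneg _ _ _ _)]
    exact lintegral_mono fun x => ENNReal.ofReal_le_ofReal (diamag α hε h.smooth i x)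
  have h3 := h1.trans (mul_le_mul_right h2 _)
  have hk : 0 ≤ kinE N α Q0 Ψ := Finset.sum_nonneg fun i _ =>
    integral_nonneg fun x => DSq_nonneg _ _ _ _ _
  rw [← ENNReal.ofReal_mul (by norm_num), ENNReal.ofReal_le_ofReal_iff (by positivity)] at h3
  linarith

lemma exists_cut (δ : ℝ) (hδ : 0 < δ) : ∃ g : ℝ → ℝ, ContDiff ℝ (⊤ : ℕ∞) g ∧
    (∀ t, g t ≠ 0) ∧ ∀ t, δ < t → g t = t := by
  set s : ℝ → ℝ := fun t => Real.smoothTransition ((t - δ / 2) / (δ / 2)) with hs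
  have hsm : ContDiff ℝ (⊤ : ℕ∞) s := by
    have : ContDiff ℝ (⊤ : ℕ∞) Real.smoothTransition := Real.smoothTransition.contDiff
    exact this.comp (by fun_prop)
  refine ⟨fun t => (1 - s t) * δ + s t * t, by fun_prop, fun t => ?_, fun t ht => ?_⟩
  · have h0 : 0 ≤ s t := Real.smoothTransition.nonneg _
    have h1 : s t ≤ 1 := Real.smoothTransition.le_one _
    apply ne_of_gt
    by_cases ht : t ≤ δ / 2
    · have : s t = 0 := Real.smoothTransition.zero_of_nonpos
        (div_nonpos_of_nonpos_of_nonneg (by linarith) (by linarith))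
      simp [this, hδ]
    · push Not at ht
      nlinarith
  · have : s t = 1 := Real.smoothTransition.one_of_one_le (by
      rw [le_div_iff₀ (by linarith)]; linarith)
    simp [this]

lemma exists_cut_neg (δ : ℝ) (hδ : 0 < δ) : ∃ g : ℝ → ℝ, ContDiff ℝ (⊤ : ℕ∞) g ∧
    (∀ t, g t ≠ 0) ∧ ∀ t, t < -δ → g t = t := by
  obtain ⟨g, h1, h2, h3⟩ := exists_cut δ hδ
  refine ⟨fun t => -g (-t), (h1.comp contDiff_neg).neg, fun t => by simpa using h2 (-t),
    fun t ht => ?_⟩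
  simp only [h3 (-t) (by linarith), neg_neg]

/-- gauge function data -/
def IsGauge (z : Plane) (Q : Set Plane) (θ : Plane → ℝ) : Prop :=
  ContDiff ℝ (⊤ : ℕ∞) θ ∧ ∀ y ∈ Q, fderiv ℝ θ y (1, 0) = (perpInv (y - z)).1 ∧
    fderiv ℝ θ y (0, 1) = (perpInv (y - z)).2

lemma gauge_fst (z : Plane) (g : ℝ → ℝ) (hg : ContDiff ℝ (⊤ : ℕ∞) g) (h0 : ∀ t, g t ≠ 0)
    (S : Set ℝ) (hS : IsOpen S) (hgS : ∀ t ∈ S, g t = t) (Q : Set Plane)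
    (hQ : ∀ y ∈ Q, y.1 - z.1 ∈ S) :
    IsGauge z Q (fun y => arctan ((y.2 - z.2) / g (y.1 - z.1))) := by
  constructor
  · have : ContDiff ℝ (⊤ : ℕ∞) (fun y : Plane => (y.2 - z.2) / g (y.1 - z.1)) :=
      ContDiff.div (by fun_prop) (hg.comp (by fun_prop)) fun y => h0 _
    exact this.arctan
  · intro y hy
    have hev : (fun y : Plane => arctan ((y.2 - z.2) / g (y.1 - z.1))) =ᶠ[𝓝 y]
        fun y => arctan ((y.2 - z.2) / (y.1 - z.1)) := by
      have hc : ContinuousAt (fun y : Plane => y.1 - z.1) y := by fun_prop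
      filter_upwards [hc.preimage_mem_nhds (hS.mem_nhds (hQ y hy))] with w hw
      rw [hgS _ hw]
    have hne : y.1 - z.1 ≠ 0 := by rw [← hgS _ (hQ y hy)]; exact h0 _
    have e2 : HasFDerivAt (fun y : Plane => y.2 - z.2) (ContinuousLinearMap.snd ℝ ℝ ℝ) y :=
      hasFDerivAt_snd.sub_const _
    have e1 : HasFDerivAt (fun y : Plane => y.1 - z.1) (ContinuousLinearMap.fst ℝ ℝ ℝ) y :=
      hasFDerivAt_fst.sub_const _
    have hd := (e2.mul ((hasDerivAt_inv hne).comp_hasFDerivAt y e1)).arctan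
    simp only [div_eq_mul_inv] at hev ⊢
    rw [hev.fderiv_eq, show fderiv ℝ (fun y : Plane => arctan ((y.2 - z.2) * (y.1 - z.1)⁻¹)) y = _
      from hd.fderiv]
    have hp : (y.1 - z.1) ^ 2 + (y.2 - z.2) ^ 2 ≠ 0 := by positivity
    constructor
    · simp [perpInv]; field_simp; try ring
    · simp [perpInv]; field_simp; try ring

lemma gauge_snd (z : Plane) (g : ℝ → ℝ) (hg : ContDiff ℝ (⊤ : ℕ∞) g) (h0 : ∀ t, g t ≠ 0)
    (S : Set ℝ) (hS : IsOpen S) (hgS : ∀ t ∈ S, g t = t) (Q : Set Plane)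
    (hQ : ∀ y ∈ Q, y.2 - z.2 ∈ S) :
    IsGauge z Q (fun y => -arctan ((y.1 - z.1) / g (y.2 - z.2))) := by
  constructor
  · have : ContDiff ℝ (⊤ : ℕ∞) (fun y : Plane => (y.1 - z.1) / g (y.2 - z.2)) :=
      ContDiff.div (by fun_prop) (hg.comp (by fun_prop)) fun y => h0 _
    exact this.arctan.neg
  · intro y hy
    have hev : (fun y : Plane => -arctan ((y.1 - z.1) / g (y.2 - z.2))) =ᶠ[𝓝 y]
        fun y => -arctan ((y.1 - z.1) / (y.2 - z.2)) := by
      have hc : ContinuousAt (fun y : Plane => y.2 - z.2) y := by fun_prop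
      filter_upwards [hc.preimage_mem_nhds (hS.mem_nhds (hQ y hy))] with w hw
      rw [hgS _ hw]
    have hne : y.2 - z.2 ≠ 0 := by rw [← hgS _ (hQ y hy)]; exact h0 _
    have e2 : HasFDerivAt (fun y : Plane => y.2 - z.2) (ContinuousLinearMap.snd ℝ ℝ ℝ) y :=
      hasFDerivAt_snd.sub_const _
    have e1 : HasFDerivAt (fun y : Plane => y.1 - z.1) (ContinuousLinearMap.fst ℝ ℝ ℝ) y :=
      hasFDerivAt_fst.sub_const _
    have hd := (e1.mul ((hasDerivAt_inv hne).comp_hasFDerivAt y e2)).arctan.neg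
    simp only [div_eq_mul_inv] at hev ⊢
    rw [hev.fderiv_eq, show fderiv ℝ (fun y : Plane => -arctan ((y.1 - z.1) * (y.2 - z.2)⁻¹)) y = _
      from hd.fderiv]
    have hp : (y.1 - z.1) ^ 2 + (y.2 - z.2) ^ 2 ≠ 0 := by positivity
    constructor
    · simp [perpInv]; field_simp; try ring
    · simp [perpInv]; field_simp; try ring

/-- left end point of a half interval -/
def crn (b : Bool) : ℝ := if b then 1 / 2 else 0

/-- half intervals -/
def hI (b : Bool) : Set ℝ := Ioo (crn b) (crn b + 1 / 2)

/-- open quadrants of the unit square -/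
def qd (k : Bool × Bool) : Set Plane := hI k.1 ×ˢ hI k.2

/-- points of the open square outside the closed quadrant -/
def qc (k : Bool × Bool) : Set Plane := {z | z ∈ Q0 ∧ (z.1 ∈ hI (!k.1) ∨ z.2 ∈ hI (!k.2))}

lemma sep_cut (b : Bool) (s : ℝ) (hs : s ∈ hI (!b)) : ∃ (g : ℝ → ℝ) (S : Set ℝ),
    ContDiff ℝ (⊤ : ℕ∞) g ∧ (∀ t, g t ≠ 0) ∧ IsOpen S ∧ (∀ t ∈ S, g t = t) ∧
    ∀ r ∈ hI b, r - s ∈ S := by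
  cases b with
  | true =>
    simp only [hI, crn, mem_Ioo, Bool.not_true] at *
    obtain ⟨g, h1, h2, h3⟩ := exists_cut (1 / 2 - s) (by norm_num at *; linarith)
    refine ⟨g, Ioi (1 / 2 - s), h1, h2, isOpen_Ioi, h3, fun r hr => ?_⟩
    simp only [mem_Ioi]; norm_num at *; linarith
  | false =>
    simp only [hI, crn, mem_Ioo, Bool.not_false] at *
    obtain ⟨g, h1, h2, h3⟩ := exists_cut_neg (s - 1 / 2) (by norm_num at *; linarith)
    refine ⟨g, Iio (-(s - 1 / 2)), h1, h2, isOpen_Iio, h3, fun r hr => ?_⟩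
    simp only [mem_Iio]; norm_num at *; linarith

lemma exists_gauge (k : Bool × Bool) (z : Plane) (hz : z ∈ qc k) :
    ∃ θ, IsGauge z (qd k) θ := by
  rcases hz.2 with h | h
  · obtain ⟨g, S, h1, h2, h3, h4, h5⟩ := sep_cut _ _ h
    exact ⟨_, gauge_fst z g h1 h2 S h3 h4 _ fun y hy => h5 _ hy.1⟩
  · obtain ⟨g, S, h1, h2, h3, h4, h5⟩ := sep_cut _ _ h
    exact ⟨_, gauge_snd z g h1 h2 S h3 h4 _ fun y hy => h5 _ hy.2⟩

lemma kinE_nonneg (N : ℕ) (α : ℝ) (Ω : Set Plane) (Ψ : Config N → ℂ) : 0 ≤ kinE N α Ω Ψ :=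
  Finset.sum_nonneg fun _ _ => integral_nonneg fun _ => DSq_nonneg _ _ _ _ _

lemma admissible_smul {N : ℕ} {Ψ : Config N → ℂ} (h : Admissible N Ψ) (c : ℝ) :
    Admissible N (fun x => (c : ℂ) * Ψ x) := by
  obtain ⟨U, h1, h2, h3⟩ := h.vanishes
  exact ⟨contDiff_const.mul h.smooth, fun σ x => by rw [h.symm σ x],
    U, h1, h2, fun x hx => by simp [h3 x hx]⟩

lemma DSq_smul {N : ℕ} {Ψ : Config N → ℂ} (h : Admissible N Ψ) (c α : ℝ) (j : Fin N)
    (x : Config N) : DSq N α j (fun x => (c : ℂ) * Ψ x) x = c ^ 2 * DSq N α j Ψ x := by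
  have hd : DifferentiableAt ℝ Ψ x := h.smooth.differentiable (by simp) x
  have hf : fderiv ℝ (fun x => (c : ℂ) * Ψ x) x = (c : ℂ) • fderiv ℝ Ψ x :=
    (hd.hasFDerivAt.const_mul (c : ℂ)).fderiv
  have key : ∀ (d a : ℂ), ‖-Complex.I * (c * d) + a * (c * Ψ x)‖ ^ 2 =
      c ^ 2 * ‖-Complex.I * d + a * Ψ x‖ ^ 2 := by
    intro d a
    rw [show -Complex.I * (c * d) + a * (c * Ψ x) = c * (-Complex.I * d + a * Ψ x) by ring,
      norm_mul, mul_pow, Complex.norm_real, Real.norm_eq_abs, sq_abs]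
  unfold DSq DOp pder
  rw [hf]
  simp only [smul_apply, smul_eq_mul, key]
  ring

lemma kinE_smul {N : ℕ} {Ψ : Config N → ℂ} (h : Admissible N Ψ) (c α : ℝ) (Ω : Set Plane) :
    kinE N α Ω (fun x => (c : ℂ) * Ψ x) = c ^ 2 * kinE N α Ω Ψ := by
  unfold kinE
  simp_rw [DSq_smul h, integral_const_mul, Finset.mul_sum]

lemma normSq_smul {N : ℕ} (Ψ : Config N → ℂ) (c : ℝ) (Ω : Set Plane) :
    normSq N Ω (fun x => (c : ℂ) * Ψ x) = c ^ 2 * normSq N Ω Ψ := by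
  unfold normSq
  simp_rw [norm_mul, mul_pow, integral_const_mul, Complex.norm_real, Real.norm_eq_abs, sq_abs]

lemma EN_le {N : ℕ} (hN : N ≠ 0) (α : ℝ) {Ψ : Config N → ℂ} (h : Admissible N Ψ) :
    EN N α * normSq N Q0 Ψ ≤ kinE N α Q0 Ψ := by
  have hn : 0 ≤ normSq N Q0 Ψ := integral_nonneg fun _ => by positivity
  rcases hn.eq_or_lt with h0 | h0
  · rw [← h0, mul_zero]; exact kinE_nonneg _ _ _ _
  · set c := (√(normSq N Q0 Ψ))⁻¹ with hc
    have hc2 : c ^ 2 = (normSq N Q0 Ψ)⁻¹ := by rw [hc, inv_pow, Real.sq_sqrt hn]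
    have : EN N α ≤ c ^ 2 * kinE N α Q0 Ψ := by
      unfold EN neumannE
      rw [if_neg hN]
      refine csInf_le ⟨0, ?_⟩ ⟨_, admissible_smul h c, ?_, (kinE_smul h c α Q0).symm⟩
      · rintro _ ⟨Φ, _, _, rfl⟩; exact kinE_nonneg _ _ _ _
      · rw [normSq_smul, hc2, inv_mul_cancel₀ h0.ne']
    rw [hc2] at this
    calc EN N α * normSq N Q0 Ψ ≤ ((normSq N Q0 Ψ)⁻¹ * kinE N α Q0 Ψ) * normSq N Q0 Ψ := by gcongr
      _ = _ := by field_simp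

lemma EN_nonneg (N : ℕ) (α : ℝ) : 0 ≤ EN N α := by
  unfold EN neumannE
  split_ifs
  · exact le_rfl
  · refine Real.sInf_nonneg ?_
    rintro _ ⟨Φ, _, _, rfl⟩; exact kinE_nonneg _ _ _ _

/-- affine map of the unit square onto a quadrant -/
def Tk (k : Bool × Bool) (p : Plane) : Plane := (crn k.1 + p.1 / 2, crn k.2 + p.2 / 2)

lemma Tk_mem (k : Bool × Bool) {p : Plane} (hp : p ∈ Q0) : Tk k p ∈ qd k := by
  obtain ⟨⟨h1, h2⟩, h3, h4⟩ := hp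
  refine ⟨⟨?_, ?_⟩, ?_, ?_⟩ <;> simp only [Tk] <;> linarith

lemma perpInv_Tk (k : Bool × Bool) (a b : Plane) :
    perpInv (Tk k a - Tk k b) = (2 : ℝ) • perpInv (a - b) := by
  by_cases h : a - b = 0
  · have : a = b := sub_eq_zero.1 h
    subst this; simp [perpInv]
  · have hd := perpInv_den_ne h
    have e1 : (Tk k a - Tk k b).1 = (a - b).1 / 2 := by simp [Tk]; ring
    have e2 : (Tk k a - Tk k b).2 = (a - b).2 / 2 := by simp [Tk]; ring
    unfold perpInv
    rw [e1, e2]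
    have e3 : ((a - b).1 / 2) ^ 2 + ((a - b).2 / 2) ^ 2 = ((a - b).1 ^ 2 + (a - b).2 ^ 2) / 4 := by
      ring
    rw [e3]
    ext
    · simp only [Prod.smul_fst, smul_eq_mul]; field_simp; norm_num
    · simp only [Prod.smul_snd, smul_eq_mul]; field_simp; norm_num

lemma hasFDerivAt_Tk (k : Bool × Bool) (p : Plane) :
    HasFDerivAt (Tk k) ((1 / 2 : ℝ) • ContinuousLinearMap.id ℝ Plane) p := by
  have e : Tk k = fun p : Plane => (crn k.1, crn k.2) + (1 / 2 : ℝ) • p := by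
    funext p; ext <;> simp [Tk] <;> ring
  rw [e]
  exact ((hasFDerivAt_id p).const_smul (1 / 2 : ℝ)).const_add _

lemma contDiff_Tk (k : Bool × Bool) : ContDiff ℝ (⊤ : ℕ∞) (Tk k) := by
  unfold Tk; fun_prop

/-- insert the rescaled pair in slots `j`, `l` -/
def Lm {N : ℕ} (k : Bool × Bool) (j l : Fin N) (x : Config N) (y : Config 2) : Config N :=
  fun i => if i = j then Tk k (y 0) else if i = l then Tk k (y 1) else x i

/-- linear part of `Lm` -/
def LmL {N : ℕ} (j l : Fin N) : Config 2 →L[ℝ] Config N :=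
  ContinuousLinearMap.pi fun i => if i = j then (1 / 2 : ℝ) • ContinuousLinearMap.proj 0
    else if i = l then (1 / 2 : ℝ) • ContinuousLinearMap.proj 1 else 0

lemma contDiff_Lm {N : ℕ} (k : Bool × Bool) (j l : Fin N) (x : Config N) :
    ContDiff ℝ (⊤ : ℕ∞) (Lm k j l x) := by
  rw [contDiff_pi]
  intro i
  unfold Lm
  split_ifs
  · exact (contDiff_Tk k).comp (contDiff_apply ℝ Plane 0)
  · exact (contDiff_Tk k).comp (contDiff_apply ℝ Plane 1)
  · exact contDiff_const

lemma hasFDerivAt_Tk_proj (k : Bool × Bool) (a : Fin 2) (y : Config 2) :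
    HasFDerivAt (fun y : Config 2 => Tk k (y a))
      ((1 / 2 : ℝ) • ContinuousLinearMap.proj (R := ℝ) (φ := fun _ : Fin 2 => Plane) a) y := by
  have := (hasFDerivAt_Tk k (y a)).comp y
    (ContinuousLinearMap.proj (R := ℝ) (φ := fun _ : Fin 2 => Plane) a).hasFDerivAt
  exact this

lemma hasFDerivAt_Lm {N : ℕ} (k : Bool × Bool) (j l : Fin N) (x : Config N) (y : Config 2) :
    HasFDerivAt (Lm k j l x) (LmL j l) y := by
  rw [hasFDerivAt_pi']
  intro i
  have e : (ContinuousLinearMap.proj (R := ℝ) (φ := fun _ : Fin N => Plane) i).comp (LmL j l) =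
    if i = j then (1 / 2 : ℝ) • ContinuousLinearMap.proj 0
    else if i = l then (1 / 2 : ℝ) • ContinuousLinearMap.proj 1 else 0 := rfl
  rw [e]
  unfold Lm
  split_ifs
  · exact hasFDerivAt_Tk_proj k 0 y
  · exact hasFDerivAt_Tk_proj k 1 y
  · exact hasFDerivAt_const _ _

lemma LmL_single_zero {N : ℕ} (j l : Fin N) (v : Plane) :
    LmL j l (Pi.single 0 v) = (1 / 2 : ℝ) • Pi.single (M := fun _ => Plane) j v := by
  funext i
  simp only [LmL, ContinuousLinearMap.pi_apply, Pi.smul_apply]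
  by_cases h : i = j
  · subst h; simp
  · by_cases h' : i = l
    · subst h'; simp [h]
    · simp [h, h']

lemma LmL_single_one {N : ℕ} {j l : Fin N} (hjl : j ≠ l) (v : Plane) :
    LmL j l (Pi.single 1 v) = (1 / 2 : ℝ) • Pi.single (M := fun _ => Plane) l v := by
  funext i
  simp only [LmL, ContinuousLinearMap.pi_apply, Pi.smul_apply]
  by_cases h : i = j
  · subst h; simp [hjl]
  · by_cases h' : i = l
    · subst h'; simp [h]
    · simp [h, h']

/-- the gauge-transformed slice -/
def Phi {N : ℕ} (α : ℝ) (k : Bool × Bool) (j l : Fin N) (x : Config N) (F : Plane → ℝ)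
    (Ψ : Config N → ℂ) (y : Config 2) : ℂ :=
  Complex.exp (Complex.I * ((α * (F (Tk k (y 0)) + F (Tk k (y 1))) : ℝ) : ℂ)) * Ψ (Lm k j l x y)

lemma norm_Phi {N : ℕ} (α : ℝ) (k : Bool × Bool) (j l : Fin N) (x : Config N) (F : Plane → ℝ)
    (Ψ : Config N → ℂ) (y : Config 2) : ‖Phi α k j l x F Ψ y‖ = ‖Ψ (Lm k j l x y)‖ := by
  unfold Phi
  rw [norm_mul, mul_comm Complex.I, Complex.norm_exp_ofReal_mul_I, one_mul]

lemma admissible_Phi {N : ℕ} (α : ℝ) (k : Bool × Bool) {j l : Fin N} (hjl : j ≠ l)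
    (x : Config N) {F : Plane → ℝ} (hF : ContDiff ℝ (⊤ : ℕ∞) F) {Ψ : Config N → ℂ}
    (h : Admissible N Ψ) : Admissible 2 (Phi α k j l x F Ψ) := by
  have hT : ∀ a : Fin 2, ContDiff ℝ (⊤ : ℕ∞) fun y : Config 2 => F (Tk k (y a)) := fun a =>
    hF.comp ((contDiff_Tk k).comp (contDiff_apply ℝ Plane a))
  refine ⟨?_, ?_, ?_⟩
  · unfold Phi
    refine ContDiff.mul (ContDiff.cexp (contDiff_const.mul ?_)) (h.smooth.comp (contDiff_Lm _ _ _ _))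
    exact Complex.ofRealCLM.contDiff.comp (contDiff_const.mul ((hT 0).add (hT 1)))
  · intro σ y
    have hσ : σ = 1 ∨ σ = Equiv.swap 0 1 := by
      revert σ; decide
    rcases hσ with rfl | rfl
    · rfl
    · have e : Lm k j l x (y ∘ (Equiv.swap (0 : Fin 2) 1)) =
          Lm k j l x y ∘ (Equiv.swap j l) := by
        funext i
        by_cases h1 : i = j
        · subst h1; simp [Lm, hjl.symm]
        · by_cases h2 : i = l
          · subst h2; simp [Lm, h1]
          · simp [Lm, h1, h2, Equiv.swap_apply_of_ne_of_ne h1 h2]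
      unfold Phi
      rw [e, h.symm]
      simp [add_comm]
  · obtain ⟨U, h1, h2, h3⟩ := h.vanishes
    refine ⟨Lm k j l x ⁻¹' U, h1.preimage (contDiff_Lm k j l x).continuous, ?_, ?_⟩
    · rintro y ⟨a, b, hab, hy⟩
      have hy01 : y 0 = y 1 := by
        fin_cases a <;> fin_cases b <;> simp_all
      exact h2 ⟨j, l, hjl, by simp [Lm, hjl.symm, hy01]⟩
    · intro y hy
      unfold Phi
      rw [h3 _ hy, mul_zero]

lemma fderiv_Phi {N : ℕ} (α : ℝ) (k : Bool × Bool) (j l : Fin N)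
    (x : Config N) {F : Plane → ℝ} (hF : ContDiff ℝ (⊤ : ℕ∞) F) {Ψ : Config N → ℂ}
    (h : Admissible N Ψ) (y w : Config 2) :
    fderiv ℝ (Phi α k j l x F Ψ) y w =
      Complex.exp (Complex.I * ((α * (F (Tk k (y 0)) + F (Tk k (y 1))) : ℝ) : ℂ)) *
      (Complex.I * ((α * (1 / 2 * (fderiv ℝ F (Tk k (y 0)) (w 0) +
        fderiv ℝ F (Tk k (y 1)) (w 1))) : ℝ) : ℂ) * Ψ (Lm k j l x y) +
        fderiv ℝ Ψ (Lm k j l x y) (LmL j l w)) := by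
  have hT : ∀ a : Fin 2, HasFDerivAt (fun y : Config 2 => F (Tk k (y a)))
      ((fderiv ℝ F (Tk k (y a))).comp ((1 / 2 : ℝ) •
        ContinuousLinearMap.proj (R := ℝ) (φ := fun _ : Fin 2 => Plane) a)) y := fun a =>
    (hF.differentiable (by simp) (Tk k (y a))).hasFDerivAt.comp y (hasFDerivAt_Tk_proj k a y)
  have h1 := (((hT 0).add (hT 1)).const_mul α)
  have h2 := (Complex.ofRealCLM.hasFDerivAt.comp y h1).const_mul Complex.I
  have h3 := h2.cexp
  have h4 := (h.smooth.differentiable (by simp) (Lm k j l x y)).hasFDerivAt.comp y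
    (hasFDerivAt_Lm k j l x y)
  have h5 : fderiv ℝ (Phi α k j l x F Ψ) y = _ := (h3.mul h4).fderiv
  rw [h5]
  simp
  ring

lemma abPot_two_zero (y : Config 2) : abPot 2 0 y = perpInv (y 0 - y 1) := by
  unfold abPot
  rw [show (Finset.univ : Finset (Fin 2)).erase 0 = {1} by decide, Finset.sum_singleton]

lemma abPot_two_one (y : Config 2) : abPot 2 1 y = perpInv (y 1 - y 0) := by
  unfold abPot
  rw [show (Finset.univ : Finset (Fin 2)).erase 1 = {0} by decide, Finset.sum_singleton]

lemma abPot_Lm_j {N : ℕ} (k : Bool × Bool) {j l : Fin N} (hjl : j ≠ l) (x : Config N)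
    (y : Config 2) : abPot N j (Lm k j l x y) = (2 : ℝ) • abPot 2 0 y +
      ∑ i ∈ (Finset.univ.erase j).erase l, perpInv (Tk k (y 0) - x i) := by
  unfold abPot
  rw [← Finset.add_sum_erase (Finset.univ.erase j) _
    (show l ∈ Finset.univ.erase j by simp [hjl.symm])]
  have := abPot_two_zero y
  unfold abPot at this
  rw [this, ← perpInv_Tk k]
  congr 1
  · simp [Lm, hjl.symm]
  · refine Finset.sum_congr rfl fun i hi => ?_
    have h1 : i ≠ l := Finset.ne_of_mem_erase hi
    have h2 : i ≠ j := Finset.ne_of_mem_erase (Finset.mem_of_mem_erase hi)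
    simp [Lm, h1, h2]

lemma abPot_Lm_l {N : ℕ} (k : Bool × Bool) {j l : Fin N} (hjl : j ≠ l) (x : Config N)
    (y : Config 2) : abPot N l (Lm k j l x y) = (2 : ℝ) • abPot 2 1 y +
      ∑ i ∈ (Finset.univ.erase j).erase l, perpInv (Tk k (y 1) - x i) := by
  unfold abPot
  rw [← Finset.add_sum_erase (Finset.univ.erase l) _
    (show j ∈ Finset.univ.erase l by simp [hjl]), Finset.erase_right_comm]
  have := abPot_two_one y
  unfold abPot at this
  rw [this, ← perpInv_Tk k]
  congr 1
  · simp [Lm, hjl.symm]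
  · refine Finset.sum_congr rfl fun i hi => ?_
    have h1 : i ≠ j := by grind
    have h2 : i ≠ l := by grind
    simp [Lm, h1, h2, hjl.symm]

lemma phase_norm (β f a A : ℝ) (α : ℝ) (d ψ : ℂ) (hA : A = 2 * a + f) :
    ‖-Complex.I * (Complex.exp (Complex.I * (β : ℂ)) *
      (Complex.I * ((α * (1 / 2 * f) : ℝ) : ℂ) * ψ + (1 / 2 : ℝ) • d)) +
      ((α * a : ℝ) : ℂ) * (Complex.exp (Complex.I * (β : ℂ)) * ψ)‖ ^ 2 =
    1 / 4 * ‖-Complex.I * d + ((α * A : ℝ) : ℂ) * ψ‖ ^ 2 := by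
  have e : -Complex.I * (Complex.exp (Complex.I * (β : ℂ)) *
      (Complex.I * ((α * (1 / 2 * f) : ℝ) : ℂ) * ψ + (1 / 2 : ℝ) • d)) +
      ((α * a : ℝ) : ℂ) * (Complex.exp (Complex.I * (β : ℂ)) * ψ) =
      Complex.exp ((β : ℂ) * Complex.I) * (((1 / 2 : ℝ) : ℂ) *
        (-Complex.I * d + ((α * A : ℝ) : ℂ) * ψ)) := by
    rw [hA, mul_comm (β : ℂ), Complex.real_smul]
    push_cast
    linear_combination (-Complex.exp (Complex.I * (β : ℂ)) * α * (1 / 2) * f * ψ) *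
      Complex.I_sq
  rw [e, norm_mul, Complex.norm_exp_ofReal_mul_I, one_mul, norm_mul, mul_pow]
  congr 1
  rw [Complex.norm_real]; norm_num

lemma DSq_Phi {N : ℕ} (α : ℝ) (k : Bool × Bool) {j l : Fin N} (hjl : j ≠ l)
    (x : Config N) {F : Plane → ℝ} (hF : ContDiff ℝ (⊤ : ℕ∞) F)
    (hF1 : ∀ p ∈ qd k, fderiv ℝ F p (1, 0) =
      (∑ i ∈ (Finset.univ.erase j).erase l, perpInv (p - x i)).1)
    (hF2 : ∀ p ∈ qd k, fderiv ℝ F p (0, 1) =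
      (∑ i ∈ (Finset.univ.erase j).erase l, perpInv (p - x i)).2)
    {Ψ : Config N → ℂ} (h : Admissible N Ψ) (y : Config 2) (hy : y ∈ cube 2 Q0) :
    DSq 2 α 0 (Phi α k j l x F Ψ) y = 1 / 4 * DSq N α j Ψ (Lm k j l x y) ∧
    DSq 2 α 1 (Phi α k j l x F Ψ) y = 1 / 4 * DSq N α l Ψ (Lm k j l x y) := by
  have m0 : Tk k (y 0) ∈ qd k := Tk_mem k (hy 0 (mem_univ _))
  have m1 : Tk k (y 1) ∈ qd k := Tk_mem k (hy 1 (mem_univ _))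
  constructor
  · unfold DSq DOp pder
    simp only [fderiv_Phi α k j l x hF h, LmL_single_zero, map_smul]
    rw [mul_add (1 / 4 : ℝ)]
    simp only [Pi.single_eq_same, ne_eq, one_ne_zero, not_false_eq_true, Pi.single_eq_of_ne,
      map_zero, add_zero]
    unfold Phi
    refine congrArg₂ (HAdd.hAdd : ℝ → ℝ → ℝ) ?_ ?_
    · refine phase_norm _ _ _ _ _ _ _ ?_
      rw [abPot_Lm_j k hjl, hF1 _ m0]; simp
    · refine phase_norm _ _ _ _ _ _ _ ?_
      rw [abPot_Lm_j k hjl, hF2 _ m0]; simp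
  · unfold DSq DOp pder
    simp only [fderiv_Phi α k j l x hF h, LmL_single_one hjl, map_smul]
    rw [mul_add (1 / 4 : ℝ)]
    simp only [Pi.single_eq_same, ne_eq, zero_ne_one, not_false_eq_true, Pi.single_eq_of_ne,
      map_zero, zero_add]
    unfold Phi
    refine congrArg₂ (HAdd.hAdd : ℝ → ℝ → ℝ) ?_ ?_
    · refine phase_norm _ _ _ _ _ _ _ ?_
      rw [abPot_Lm_l k hjl, hF1 _ m1]; simp
    · refine phase_norm _ _ _ _ _ _ _ ?_
      rw [abPot_Lm_l k hjl, hF2 _ m1]; simp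

lemma measurableSet_cube (n : ℕ) : MeasurableSet (cube n Q0) :=
  MeasurableSet.univ_pi fun _ => measurableSet_Ioo.prod measurableSet_Ioo

lemma slice {N : ℕ} (α : ℝ) (k : Bool × Bool) {j l : Fin N} (hjl : j ≠ l)
    (x : Config N) (hx : ∀ i, i ≠ j → i ≠ l → x i ∈ qc k) {Ψ : Config N → ℂ}
    (h : Admissible N Ψ) :
    ENNReal.ofReal (4 * EN 2 α) *
      ∫⁻ y in cube 2 Q0, ENNReal.ofReal (‖Ψ (Lm k j l x y)‖ ^ 2) ≤
    ∫⁻ y in cube 2 Q0, ENNReal.ofReal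
      (DSq N α j Ψ (Lm k j l x y) + DSq N α l Ψ (Lm k j l x y)) := by
  have hθ : ∀ i, ∃ θ : Plane → ℝ, i ≠ j → i ≠ l → IsGauge (x i) (qd k) θ := by
    intro i
    by_cases h1 : i = j
    · exact ⟨0, fun h => absurd h1 h⟩
    by_cases h2 : i = l
    · exact ⟨0, fun _ h => absurd h2 h⟩
    obtain ⟨θ, hθ⟩ := exists_gauge k (x i) (hx i h1 h2)
    exact ⟨θ, fun _ _ => hθ⟩
  choose θ hθ using hθ
  set s := ((Finset.univ : Finset (Fin N)).erase j).erase l with hs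
  have hθs : ∀ i ∈ s, IsGauge (x i) (qd k) (θ i) := fun i hi =>
    hθ i (Finset.ne_of_mem_erase (Finset.mem_of_mem_erase hi)) (Finset.ne_of_mem_erase hi)
  set F : Plane → ℝ := fun p => ∑ i ∈ s, θ i p with hFdef
  have hF : ContDiff ℝ (⊤ : ℕ∞) F := ContDiff.sum fun i hi => (hθs i hi).1
  have hfd : ∀ p, fderiv ℝ F p = ∑ i ∈ s, fderiv ℝ (θ i) p := fun p =>
    (HasFDerivAt.fun_sum fun i hi =>
      ((hθs i hi).1.differentiable (by simp) p).hasFDerivAt).fderiv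
  have hF1 : ∀ p ∈ qd k, fderiv ℝ F p (1, 0) = (∑ i ∈ s, perpInv (p - x i)).1 := by
    intro p hp
    rw [hfd, _root_.sum_apply, Prod.fst_sum]
    exact Finset.sum_congr rfl fun i hi => ((hθs i hi).2 p hp).1
  have hF2 : ∀ p ∈ qd k, fderiv ℝ F p (0, 1) = (∑ i ∈ s, perpInv (p - x i)).2 := by
    intro p hp
    rw [hfd, _root_.sum_apply, Prod.snd_sum]
    exact Finset.sum_congr rfl fun i hi => ((hθs i hi).2 p hp).2
  have hP := admissible_Phi α k hjl x hF h
  have hE := EN_le two_ne_zero α hP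
  have hL := (contDiff_Lm k j l x).continuous
  have hΨ := h.smooth.continuous
  have hDj : Continuous fun y => DSq N α j Ψ (Lm k j l x y) := (continuous_DSq α j h).comp hL
  have hDl : Continuous fun y => DSq N α l Ψ (Lm k j l x y) := (continuous_DSq α l h).comp hL
  have hk : kinE 2 α Q0 (Phi α k j l x F Ψ) = 1 / 4 * ∫ y in cube 2 Q0,
      (DSq N α j Ψ (Lm k j l x y) + DSq N α l Ψ (Lm k j l x y)) := by
    unfold kinE
    rw [Fin.sum_univ_two, integral_add (integrableOn_cube hDj) (integrableOn_cube hDl), mul_add,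
      ← integral_const_mul, ← integral_const_mul]
    congr 1
    · exact setIntegral_congr_fun (measurableSet_cube 2) fun y hy =>
        (DSq_Phi α k hjl x hF hF1 hF2 h y hy).1
    · exact setIntegral_congr_fun (measurableSet_cube 2) fun y hy =>
        (DSq_Phi α k hjl x hF hF1 hF2 h y hy).2
  have hn : normSq 2 Q0 (Phi α k j l x F Ψ) = ∫ y in cube 2 Q0, ‖Ψ (Lm k j l x y)‖ ^ 2 := by
    unfold normSq; simp_rw [norm_Phi]
  rw [hk, hn] at hE
  have hsum : Continuous fun y => DSq N α j Ψ (Lm k j l x y) + DSq N α l Ψ (Lm k j l x y) :=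
    hDj.add hDl
  rw [lintegral_cube (by fun_prop) (fun _ => by positivity),
    lintegral_cube hsum (fun _ => add_nonneg (DSq_nonneg _ _ _ _ _) (DSq_nonneg _ _ _ _ _)),
    ← ENNReal.ofReal_mul (by linarith [EN_nonneg 2 α])]
  apply ENNReal.ofReal_le_ofReal
  linarith

lemma measurableSet_hI (b : Bool) : MeasurableSet (hI b) := measurableSet_Ioo

lemma measurableSet_Q0 : MeasurableSet Q0 := measurableSet_Ioo.prod measurableSet_Ioo

lemma measurableSet_qd (k : Bool × Bool) : MeasurableSet (qd k) :=
  (measurableSet_hI _).prod (measurableSet_hI _)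

lemma measurableSet_qc (k : Bool × Bool) : MeasurableSet (qc k) :=
  measurableSet_Q0.inter ((measurable_fst (measurableSet_hI _)).union
    (measurable_snd (measurableSet_hI _)))

lemma Tk_image (k : Bool × Bool) : Tk k '' Q0 = qd k := by
  ext z
  constructor
  · rintro ⟨p, hp, rfl⟩; exact Tk_mem k hp
  · rintro ⟨⟨h1, h2⟩, h3, h4⟩
    refine ⟨(2 * (z.1 - crn k.1), 2 * (z.2 - crn k.2)), ⟨⟨?_, ?_⟩, ?_, ?_⟩, ?_⟩
    · simp only; linarith
    · simp only; linarith
    · simp only; linarith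
    · simp only; linarith
    · ext <;> simp [Tk]

lemma lintegral_qd (k : Bool × Bool) (g : Plane → ENNReal) :
    ∫⁻ a in qd k, g a = ENNReal.ofReal (1 / 4) * ∫⁻ p in Q0, g (Tk k p) := by
  have hinj : InjOn (Tk k) Q0 := by
    intro a _ b _ hab
    have h1 := congrArg Prod.fst hab
    have h2 := congrArg Prod.snd hab
    simp only [Tk] at h1 h2
    ext <;> linarith
  rw [← Tk_image, lintegral_image_eq_lintegral_abs_det_fderiv_mul volume measurableSet_Q0
    (fun x _ => (hasFDerivAt_Tk k x).hasFDerivWithinAt) hinj]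
  have hdet : |((1 / 2 : ℝ) • ContinuousLinearMap.id ℝ Plane).det| = 1 / 4 := by
    have : ((1 / 2 : ℝ) • ContinuousLinearMap.id ℝ Plane).det = 1 / 4 := by
      unfold ContinuousLinearMap.det
      rw [ContinuousLinearMap.toLinearMap_smul, LinearMap.det_smul]
      simp
      norm_num
    rw [this]; norm_num
  rw [hdet, lintegral_const_mul' _ _ ENNReal.ofReal_ne_top]

/-- slots `j`, `l` in quadrant `k`, the others outside -/
def evF {N : ℕ} (j l : Fin N) (k : Bool × Bool) (i : Fin N) : Set Plane :=
  if i = j ∨ i = l then qd k else qc k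

/-- event: exactly the particles `j`, `l` in quadrant `k` -/
def ev {N : ℕ} (j l : Fin N) (k : Bool × Bool) : Set (Config N) := univ.pi (evF j l k)

lemma measurableSet_evF {N : ℕ} (j l : Fin N) (k : Bool × Bool) (i : Fin N) :
    MeasurableSet (evF j l k i) := by
  unfold evF; split_ifs
  · exact measurableSet_qd k
  · exact measurableSet_qc k

lemma measurableSet_ev {N : ℕ} (j l : Fin N) (k : Bool × Bool) : MeasurableSet (ev j l k) :=
  MeasurableSet.univ_pi fun i => measurableSet_evF j l k i

lemma lintegral_cube_two (g : Config 2 → ENNReal) (hg : Measurable g) :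
    ∫⁻ y in cube 2 Q0, g y = ∫⁻ p in Q0, ∫⁻ q in Q0, g ![p, q] := by
  rw [restrict_cube, ← (measurePreserving_finTwoArrow (volume.restrict Q0)).symm.lintegral_comp hg,
    lintegral_prod]
  · rfl
  · exact (hg.comp (MeasurableEquiv.measurable _)).aemeasurable

lemma marg {N : ℕ} (k : Bool × Bool) {j l : Fin N} (hjl : j ≠ l) (f : Config N → ENNReal)
    (hf : Measurable f) (x : Config N) :
    lmarginal (fun i => volume.restrict (evF j l k i)) {j, l} f x =
      ENNReal.ofReal (1 / 4) * (ENNReal.ofReal (1 / 4) *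
        ∫⁻ y in cube 2 Q0, f (Lm k j l x y)) := by
  rw [lmarginal_insert _ hf (by simpa using hjl)]
  simp_rw [lmarginal_singleton]
  have e1 : evF j l k j = qd k := by simp [evF]
  have e2 : evF j l k l = qd k := by simp [evF]
  rw [e1, e2]
  simp_rw [lintegral_qd]
  rw [lintegral_cube_two (fun y => f (Lm k j l x y)) (hf.comp (contDiff_Lm k j l x).continuous.measurable),
    lintegral_const_mul' _ _ ENNReal.ofReal_ne_top]
  congr 2
  refine lintegral_congr fun p => lintegral_congr fun q => congrArg f ?_
  funext i
  by_cases h1 : i = l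
  · subst h1; simp [Lm, hjl.symm]
  · by_cases h2 : i = j
    · subst h2; simp [Lm, hjl]
    · simp [Lm, h1, h2]

lemma restrict_ev {N : ℕ} (j l : Fin N) (k : Bool × Bool) :
    (volume : Measure (Config N)).restrict (ev j l k) =
      Measure.pi fun i => volume.restrict (evF j l k i) :=
  Measure.restrict_pi_pi _ _

lemma ev_bound {N : ℕ} (α : ℝ) (k : Bool × Bool) {j l : Fin N} (hjl : j ≠ l) {Ψ : Config N → ℂ}
    (h : Admissible N Ψ) :
    ENNReal.ofReal (4 * EN 2 α) * ∫⁻ x in ev j l k, ENNReal.ofReal (‖Ψ x‖ ^ 2) ≤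
    ∫⁻ x in ev j l k, ENNReal.ofReal (DSq N α j Ψ x + DSq N α l Ψ x) := by
  set S : Set (Config N) := {x | ∀ i, i ≠ j → i ≠ l → x i ∈ qc k} with hS
  have hSm : MeasurableSet S := by
    have : S = univ.pi fun i => if i = j ∨ i = l then univ else qc k := by
      ext x
      simp only [hS, mem_ofPred_eq, mem_univ_pi]
      refine forall_congr' fun i => ?_
      by_cases h1 : i = j <;> by_cases h2 : i = l <;> simp [h1, h2]
    rw [this]
    refine MeasurableSet.univ_pi fun i => ?_
    split_ifs
    · exact MeasurableSet.univ
    · exact measurableSet_qc k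
  have hsub : ev j l k ⊆ S := by
    intro x hx i h1 h2
    have := hx i (mem_univ _)
    simpa [evF, h1, h2] using this
  have hLS : ∀ x y, Lm k j l x y ∈ S ↔ x ∈ S := by
    intro x y
    simp only [hS, mem_ofPred_eq]
    refine forall_congr' fun i => ?_
    constructor
    · intro h h1 h2; simpa [Lm, h1, h2] using h h1 h2
    · intro h h1 h2; simpa [Lm, h1, h2] using h h1 h2
  have hind : ∀ f : Config N → ENNReal, ∫⁻ x in ev j l k, f x =
      ∫⁻ x in ev j l k, S.indicator f x := fun f =>
    setLIntegral_congr_fun (measurableSet_ev j l k) fun x hx => by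
      rw [indicator_of_mem (hsub hx)]
  have hm1 : Measurable fun x => ENNReal.ofReal (4 * EN 2 α) * ENNReal.ofReal (‖Ψ x‖ ^ 2) := by
    have := h.smooth.continuous.measurable
    fun_prop
  have hm2 : Measurable fun x => ENNReal.ofReal (DSq N α j Ψ x + DSq N α l Ψ x) :=
    ENNReal.measurable_ofReal.comp
      ((continuous_DSq α j h).measurable.add (continuous_DSq α l h).measurable)
  rw [← lintegral_const_mul' _ _ ENNReal.ofReal_ne_top, hind (fun x => _ * _),
    hind (fun x => ENNReal.ofReal (_ + _)), restrict_ev]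
  refine lintegral_le_of_lmarginal_le {j, l} (hm1.indicator hSm) (hm2.indicator hSm) ?_
  intro x
  rw [marg k hjl _ (hm1.indicator hSm), marg k hjl _ (hm2.indicator hSm)]
  gcongr ENNReal.ofReal (1 / 4) * (ENNReal.ofReal (1 / 4) * ?_)
  by_cases hx : x ∈ S
  · have := slice α k hjl x hx h
    rw [← lintegral_const_mul' _ _ ENNReal.ofReal_ne_top] at this
    simpa only [indicator, hLS, hx, if_true] using this
  · simp [indicator, hLS, hx]

lemma hI_sub (b : Bool) : hI b ⊆ Ioo (0 : ℝ) 1 := by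
  intro x hx
  cases b <;> simp [hI, crn] at hx ⊢ <;> constructor <;> linarith [hx.1, hx.2]

lemma ev_sub {N : ℕ} (j l : Fin N) (k : Bool × Bool) : ev j l k ⊆ cube N Q0 := by
  intro x hx i _
  have := hx i (mem_univ _)
  unfold evF at this
  split_ifs at this
  · exact ⟨hI_sub _ this.1, hI_sub _ this.2⟩
  · exact this.1

lemma ev_bound' {N : ℕ} (α : ℝ) (k : Bool × Bool) {j l : Fin N} (hjl : j ≠ l) {Ψ : Config N → ℂ}
    (h : Admissible N Ψ) :
    4 * EN 2 α * ∫ x in ev j l k, ‖Ψ x‖ ^ 2 ≤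
    (∫ x in ev j l k, DSq N α j Ψ x) + ∫ x in ev j l k, DSq N α l Ψ x := by
  have hint : ∀ {f : Config N → ℝ}, Continuous f → IntegrableOn f (ev j l k) := fun hf =>
    (integrableOn_cube hf).mono_set (ev_sub j l k)
  have hc := h.smooth.continuous
  have hj := continuous_DSq α j h
  have hl := continuous_DSq α l h
  have key := ev_bound α k hjl h
  rw [← ofReal_integral_eq_lintegral_ofReal (hint (by fun_prop))
      (Filter.Eventually.of_forall fun _ => by positivity),
    ← ofReal_integral_eq_lintegral_ofReal (hint (f := fun x => DSq N α j Ψ x + DSq N α l Ψ x) (hj.add hl))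
      (Filter.Eventually.of_forall fun _ => add_nonneg (DSq_nonneg _ _ _ _ _) (DSq_nonneg _ _ _ _ _)),
    ← ENNReal.ofReal_mul (by linarith [EN_nonneg 2 α]),
    ENNReal.ofReal_le_ofReal_iff
      (integral_nonneg fun _ => add_nonneg (DSq_nonneg _ _ _ _ _) (DSq_nonneg _ _ _ _ _)),
    integral_add (hint hj) (hint hl)] at key
  exact key

lemma hI_disj (b : Bool) {t : ℝ} (h : t ∈ hI b) (h' : t ∈ hI (!b)) : False := by
  cases b <;> simp [hI, crn] at h h' <;> linarith [h.1, h.2, h'.1, h'.2]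

lemma hI_inj {b c : Bool} {t : ℝ} (h : t ∈ hI b) (h' : t ∈ hI c) : b = c := by
  by_contra hne
  have : c = !b := by cases b <;> cases c <;> simp_all
  subst this
  exact hI_disj b h h'

lemma qd_inj {k k' : Bool × Bool} {z : Plane} (h : z ∈ qd k) (h' : z ∈ qd k') : k = k' :=
  Prod.ext (hI_inj h.1 h'.1) (hI_inj h.2 h'.2)

lemma qd_qc {k : Bool × Bool} {z : Plane} (h : z ∈ qd k) (h' : z ∈ qc k) : False := by
  rcases h'.2 with h2 | h2
  · exact hI_disj _ h.1 h2
  · exact hI_disj _ h.2 h2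

lemma qd_sub_Q0 (k : Bool × Bool) : qd k ⊆ Q0 := fun _ h => ⟨hI_sub _ h.1, hI_sub _ h.2⟩

lemma vol_qd (k : Bool × Bool) : volume (qd k) = ENNReal.ofReal (1 / 4) := by
  have := lintegral_qd k 1
  simp only [Pi.one_apply, lintegral_one, Measure.restrict_apply_univ] at this
  rw [this]
  have h1 : (volume : Measure Plane) Q0 = 1 := by
    have := measure_univ (μ := (volume : Measure Plane).restrict Q0)
    rwa [Measure.restrict_apply_univ] at this
  rw [h1, mul_one]

lemma vol_qc (k : Bool × Bool) : ENNReal.ofReal (3 / 4) ≤ volume (qc k) := by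
  have hd : ∀ {a b : Bool × Bool}, a ≠ b → Disjoint (qd a) (qd b) := fun hab =>
    Set.disjoint_left.2 fun _ h h' => hab (qd_inj h h')
  have hsub : (qd (!k.1, k.2) ∪ qd (k.1, !k.2)) ∪ qd (!k.1, !k.2) ⊆ qc k := by
    rintro z ((h | h) | h)
    · exact ⟨qd_sub_Q0 _ h, Or.inl h.1⟩
    · exact ⟨qd_sub_Q0 _ h, Or.inr h.2⟩
    · exact ⟨qd_sub_Q0 _ h, Or.inl h.1⟩
  refine le_trans ?_ (measure_mono hsub)
  rw [measure_union _ (measurableSet_qd _), measure_union _ (measurableSet_qd _), vol_qd, vol_qd,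
    vol_qd, ← ENNReal.ofReal_add (by norm_num) (by norm_num),
    ← ENNReal.ofReal_add (by norm_num) (by norm_num)]
  · norm_num
  · exact hd (by simp)
  · exact Disjoint.union_left (hd (by simp)) (hd (by simp))

lemma vol_ev {N : ℕ} {j l : Fin N} (hjl : j ≠ l) (k : Bool × Bool) :
    (1 / 16) * (3 / 4 : ℝ) ^ (N - 2) ≤ volume.real (ev j l k) := by
  have hfin : volume (ev j l k) ≠ ⊤ := by
    refine ne_top_of_le_ne_top ?_ (measure_mono (ev_sub j l k))
    have := measure_ne_top ((volume : Measure (Config N)).restrict (cube N Q0)) univ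
    rwa [Measure.restrict_apply_univ] at this
  unfold Measure.real
  rw [← ENNReal.ofReal_le_iff_le_toReal hfin]
  unfold ev
  rw [volume_pi_pi, ← Finset.mul_prod_erase Finset.univ _ (Finset.mem_univ j),
    ← Finset.mul_prod_erase (Finset.univ.erase j) _
      (show l ∈ Finset.univ.erase j by simp [hjl.symm])]
  have e1 : evF j l k j = qd k := by simp [evF]
  have e2 : evF j l k l = qd k := by simp [evF]
  have hcard : ((Finset.univ.erase j).erase l).card = N - 2 := by
    rw [Finset.card_erase_of_mem (by simp [hjl.symm]), Finset.card_erase_of_mem (by simp)]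
    simp; omega
  rw [e1, e2, vol_qd, ← mul_assoc, ← ENNReal.ofReal_mul (by norm_num),
    ENNReal.ofReal_mul (by norm_num), ENNReal.ofReal_pow (by norm_num), ← hcard,
    ← Finset.prod_const]
  refine mul_le_mul' (le_of_eq (by norm_num)) (Finset.prod_le_prod' fun i hi => ?_)
  have h1 : i ≠ l := Finset.ne_of_mem_erase hi
  have h2 : i ≠ j := Finset.ne_of_mem_erase (Finset.mem_of_mem_erase hi)
  simpa [evF, h1, h2] using vol_qc k

lemma sum_ev_le {N : ℕ} (j : Fin N) {f : Config N → ℝ} (hf : Continuous f) (h0 : ∀ x, 0 ≤ f x) :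
    ∑ l ∈ Finset.univ.erase j, ∑ k : Bool × Bool, ∫ x in ev j l k, f x ≤
      ∫ x in cube N Q0, f x := by
  rw [← Finset.sum_product' (f := fun l k => ∫ x in ev j l k, f x)]
  have hdis : Set.Pairwise (↑((Finset.univ.erase j) ×ˢ (Finset.univ : Finset (Bool × Bool))))
      (Function.onFun Disjoint fun p : Fin N × (Bool × Bool) => ev j p.1 p.2) := by
    rintro ⟨l, k⟩ hp ⟨l', k'⟩ hp' hne
    have hl : l ≠ j := by simpa using hp
    refine Set.disjoint_left.2 fun x hx hx' => hne ?_
    simp only at hx hx'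
    have a1 : x j ∈ qd k := by simpa [evF] using hx j (mem_univ _)
    have a2 : x j ∈ qd k' := by simpa [evF] using hx' j (mem_univ _)
    have hk := qd_inj a1 a2
    subst hk
    have a3 : x l ∈ qd k := by simpa [evF] using hx l (mem_univ _)
    by_contra hll
    have hll' : l ≠ l' := fun h => hll (by rw [h])
    have a4 : x l ∈ qc k := by simpa [evF, hl, hll'] using hx' l (mem_univ _)
    exact qd_qc a3 a4
  rw [← integral_biUnion_finset _ (fun p _ => measurableSet_ev j p.1 p.2) hdis
    (fun p _ => (integrableOn_cube hf).mono_set (ev_sub _ _ _))]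
  exact setIntegral_mono_set (integrableOn_cube hf) (Filter.Eventually.of_forall h0)
    (LE.le.eventuallyLE (Set.iUnion₂_subset fun p _ => ev_sub _ _ _))

lemma ev_comm {N : ℕ} (j l : Fin N) (k : Bool × Bool) : ev j l k = ev l j k := by
  unfold ev evF
  simp_rw [or_comm]

lemma energy_bound {N : ℕ} (α : ℝ) {Ψ : Config N → ℂ} (h : Admissible N Ψ) :
    2 * EN 2 α * ∑ j : Fin N, ∑ l ∈ Finset.univ.erase j, ∑ k : Bool × Bool,
      ∫ x in ev j l k, ‖Ψ x‖ ^ 2 ≤ kinE N α Q0 Ψ := by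
  have h1 : ∑ j : Fin N, ∑ l ∈ Finset.univ.erase j, ∑ k : Bool × Bool,
      ∫ x in ev j l k, DSq N α j Ψ x ≤ kinE N α Q0 Ψ :=
    Finset.sum_le_sum fun j _ => sum_ev_le j (continuous_DSq α j h) (DSq_nonneg N α j Ψ)
  have h2 : ∑ j : Fin N, ∑ l ∈ Finset.univ.erase j, ∑ k : Bool × Bool,
      ∫ x in ev j l k, DSq N α l Ψ x = ∑ j : Fin N, ∑ l ∈ Finset.univ.erase j, ∑ k : Bool × Bool,
      ∫ x in ev j l k, DSq N α j Ψ x := by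
    rw [Finset.sum_comm' (t' := Finset.univ) (s' := fun l => Finset.univ.erase l)
      (by intro x y; simp [eq_comm])]
    refine Finset.sum_congr rfl fun j _ => Finset.sum_congr rfl fun l _ =>
      Finset.sum_congr rfl fun k _ => ?_
    rw [ev_comm]
  have h3 : 4 * EN 2 α * ∑ j : Fin N, ∑ l ∈ Finset.univ.erase j, ∑ k : Bool × Bool,
      ∫ x in ev j l k, ‖Ψ x‖ ^ 2 ≤
      (∑ j : Fin N, ∑ l ∈ Finset.univ.erase j, ∑ k : Bool × Bool,
        ∫ x in ev j l k, DSq N α j Ψ x) +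
      ∑ j : Fin N, ∑ l ∈ Finset.univ.erase j, ∑ k : Bool × Bool,
        ∫ x in ev j l k, DSq N α l Ψ x := by
    simp_rw [Finset.mul_sum, ← Finset.sum_add_distrib]
    refine Finset.sum_le_sum fun j _ => Finset.sum_le_sum fun l hl =>
      Finset.sum_le_sum fun k _ => ?_
    exact ev_bound' α k (Finset.ne_of_mem_erase hl).symm h
  linarith

lemma pt_bound (u a : ℝ) : 7 / 10 * a ^ 2 - 7 / 3 * (u - a) ^ 2 ≤ u ^ 2 := by
  nlinarith [sq_nonneg (10 * u - 7 * a), sq_nonneg (10/3 * u - 7/3 * a)]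

lemma mass_bound {N : ℕ} (α : ℝ) {Ψ : Config N → ℂ} (h : Admissible N Ψ)
    (hn : normSq N Q0 Ψ = 1) (hE : kinE N α Q0 Ψ ≤ 3 / 20) :
    (7 / 10 * (31 / 32) - 1 / 1000) * (N * (((N - 1 : ℕ) : ℝ) * (4 *
      ((1 / 16) * (3 / 4 : ℝ) ^ (N - 2))))) - 7 / 96 * N ≤
    ∑ j : Fin N, ∑ l ∈ Finset.univ.erase j, ∑ k : Bool × Bool, ∫ x in ev j l k, ‖Ψ x‖ ^ 2 := by
  have hε : (0 : ℝ) < 1 / 1000 := by norm_num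
  have hvb := var_bound α hε h
  have hu : Continuous (regMod (1 / 1000) Ψ) := (contDiff_regMod hε h.smooth).continuous
  have hc := h.smooth.continuous
  set u := regMod (1 / 1000) Ψ with hudef
  set a := ∫ x in cube N Q0, u x with ha
  have husq : ∀ x, u x ^ 2 = ‖Ψ x‖ ^ 2 + 1 / 1000 := fun x => Real.sq_sqrt (by positivity)
  have hu2 : ∫ x in cube N Q0, u x ^ 2 = 1 + 1 / 1000 := by
    simp_rw [husq]
    rw [integral_add (integrableOn_cube (by fun_prop)) (integrable_const _), integral_const]
    simp only [probReal_univ, one_smul]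
    unfold normSq at hn; rw [hn]
  have hV : ∫ x in cube N Q0, (u x - a) ^ 2 = 1 + 1 / 1000 - a ^ 2 := by
    have e : ∀ x, (u x - a) ^ 2 = (u x ^ 2 - 2 * a * u x) + a ^ 2 := fun x => by ring
    simp_rw [e]
    rw [integral_add (integrableOn_cube (by fun_prop)) (integrable_const _),
      integral_sub (integrableOn_cube (by fun_prop)) (integrableOn_cube (by fun_prop)),
      integral_const_mul, hu2, ← ha, integral_const]
    simp only [probReal_univ, one_smul]
    ring
  rw [hu2] at hvb
  have ha2 : 31 / 32 ≤ a ^ 2 := by linarith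
  have hV' : ∫ x in cube N Q0, (u x - a) ^ 2 ≤ 1 / 32 := by rw [hV]; linarith
  set c := (7 / 10 * (31 / 32) - 1 / 1000 : ℝ) with hcdef
  set m := ((1 / 16) * (3 / 4 : ℝ) ^ (N - 2)) with hm
  have hc0 : 0 ≤ c := by rw [hcdef]; norm_num
  have hone : ∀ j : Fin N, ∀ l ∈ Finset.univ.erase j, ∀ k : Bool × Bool,
      c * m - 7 / 3 * ∫ x in ev j l k, (u x - a) ^ 2 ≤ ∫ x in ev j l k, ‖Ψ x‖ ^ 2 := by
    intro j l hl k
    have hint : ∀ {f : Config N → ℝ}, Continuous f → IntegrableOn f (ev j l k) := fun hf =>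
      (integrableOn_cube hf).mono_set (ev_sub j l k)
    have hv := vol_ev (Finset.ne_of_mem_erase hl).symm k
    have h1 : ∫ x in ev j l k, (c - 7 / 3 * (u x - a) ^ 2) ≤ ∫ x in ev j l k, ‖Ψ x‖ ^ 2 := by
      refine setIntegral_mono (hint (by fun_prop)) (hint (by fun_prop)) fun x => ?_
      have := pt_bound (u x) a
      rw [husq] at this
      simp only [hcdef]
      linarith
    rw [integral_sub (hint (by fun_prop)) (hint (by fun_prop)), integral_const_mul,
      setIntegral_const, smul_eq_mul] at h1
    have := mul_le_mul_of_nonneg_left hv hc0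
    linarith
  calc c * (N * (((N - 1 : ℕ) : ℝ) * (4 * m))) - 7 / 96 * N
      ≤ ∑ j : Fin N, (c * (((N - 1 : ℕ) : ℝ) * (4 * m)) -
          7 / 3 * ∫ x in cube N Q0, (u x - a) ^ 2) := by
        rw [Finset.sum_const, Finset.card_univ, Fintype.card_fin, nsmul_eq_mul]
        have : (0 : ℝ) ≤ N := Nat.cast_nonneg _
        nlinarith
    _ ≤ ∑ j : Fin N, ∑ l ∈ Finset.univ.erase j, ∑ k : Bool × Bool,
          (c * m - 7 / 3 * ∫ x in ev j l k, (u x - a) ^ 2) := by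
        refine Finset.sum_le_sum fun j _ => ?_
        have := sum_ev_le j (f := fun x => (u x - a) ^ 2) (by fun_prop) (fun _ => sq_nonneg _)
        simp_rw [Finset.sum_sub_distrib, ← Finset.mul_sum]
        simp only [Finset.sum_const, Finset.card_univ, nsmul_eq_mul, Fintype.card_prod,
          Fintype.card_bool, Finset.card_erase_of_mem (Finset.mem_univ j), Fintype.card_fin]
        push_cast
        linarith
    _ ≤ _ := Finset.sum_le_sum fun j _ => Finset.sum_le_sum fun l hl =>
        Finset.sum_le_sum fun k _ => hone j l hl k

lemma final_bound {N : ℕ} (hN : N = 3 ∨ N = 4) (α : ℝ) {Ψ : Config N → ℂ} (h : Admissible N Ψ)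
    (hn : normSq N Q0 Ψ = 1) (hE : kinE N α Q0 Ψ ≤ 3 / 20) : EN 2 α ≤ kinE N α Q0 Ψ := by
  have h1 := mass_bound α h hn hE
  have h2 := energy_bound α h
  have h3 := EN_nonneg 2 α
  set T := ∑ j : Fin N, ∑ l ∈ Finset.univ.erase j, ∑ k : Bool × Bool, ∫ x in ev j l k, ‖Ψ x‖ ^ 2
  have hT : 1 / 2 ≤ T := by
    refine le_trans ?_ h1
    rcases hN with rfl | rfl <;> norm_num
  nlinarith

/-- a smooth cutoff vanishing near coincidence -/
def cutg (v : Plane) : ℝ := Real.smoothTransition (100 * (v.1 ^ 2 + v.2 ^ 2) - 1)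

/-- product trial state -/
def trial (N : ℕ) (x : Config N) : ℂ :=
  ∏ j : Fin N, ∏ k : Fin N, if j = k then 1 else ((cutg (x j - x k) : ℝ) : ℂ)

lemma contDiff_cutg : ContDiff ℝ (⊤ : ℕ∞) cutg := by
  unfold cutg
  refine Real.smoothTransition.contDiff.comp ?_
  fun_prop

lemma admissible_trial (N : ℕ) : Admissible N (trial N) := by
  refine ⟨?_, ?_, ?_⟩
  · unfold trial
    refine contDiff_prod fun j _ => contDiff_prod fun k _ => ?_
    split_ifs
    · exact contDiff_const
    · exact Complex.ofRealCLM.contDiff.comp (contDiff_cutg.comp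
        ((contDiff_apply ℝ Plane j).sub (contDiff_apply ℝ Plane k)))
  · intro σ x
    unfold trial
    rw [← Equiv.prod_comp σ (fun j => ∏ k : Fin N, if j = k then (1 : ℂ) else
      ((cutg (x j - x k) : ℝ) : ℂ))]
    refine Finset.prod_congr rfl fun j _ => ?_
    rw [← Equiv.prod_comp σ (fun k => if σ j = k then (1 : ℂ) else
      ((cutg (x (σ j) - x k) : ℝ) : ℂ))]
    refine Finset.prod_congr rfl fun k _ => ?_
    simp
  · refine ⟨⋃ j : Fin N, ⋃ k : Fin N, ⋃ _ : j ≠ k,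
      {x : Config N | (x j - x k).1 ^ 2 + (x j - x k).2 ^ 2 < 1 / 100}, ?_, ?_, ?_⟩
    · refine isOpen_iUnion fun j => isOpen_iUnion fun k => isOpen_iUnion fun _ => ?_
      exact isOpen_lt (by fun_prop) continuous_const
    · rintro x ⟨j, k, hjk, hx⟩
      simp only [mem_iUnion]
      refine ⟨j, k, hjk, ?_⟩
      show (x j - x k).1 ^ 2 + (x j - x k).2 ^ 2 < 1 / 100
      rw [hx]; simp
    · intro x hx
      simp only [mem_iUnion] at hx
      obtain ⟨j, k, hjk, hx⟩ := hx
      have hx' : (x j - x k).1 ^ 2 + (x j - x k).2 ^ 2 < 1 / 100 := hx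
      refine Finset.prod_eq_zero (Finset.mem_univ j) (Finset.prod_eq_zero (Finset.mem_univ k) ?_)
      rw [if_neg hjk, cutg, Real.smoothTransition.zero_of_nonpos (by linarith)]
      simp

lemma isOpen_cube (N : ℕ) : IsOpen (cube N Q0) :=
  isOpen_set_pi finite_univ fun _ _ => isOpen_Ioo.prod isOpen_Ioo

lemma trial_pos {N : ℕ} (hN : N ≤ 4) : 0 < normSq N Q0 (trial N) := by
  have hc := (admissible_trial N).smooth.continuous
  have hn : 0 ≤ normSq N Q0 (trial N) := integral_nonneg fun _ => by positivity
  refine lt_of_le_of_ne hn fun h0 => ?_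
  have hc2 : Continuous fun x => ‖trial N x‖ ^ 2 := by fun_prop
  have hae := (integral_eq_zero_iff_of_nonneg (fun x => by positivity)
    (integrableOn_cube hc2)).1 h0.symm
  have hz := Measure.eqOn_open_of_ae_eq hae (isOpen_cube N) hc2.continuousOn continuousOn_const
  set p : Config N := fun j => (((j : ℕ) + 1 : ℝ) / 6, 1 / 2) with hp
  have hpc : p ∈ cube N Q0 := by
    intro j _
    have hj : ((j : ℕ) : ℝ) + 1 ≤ 4 := by exact_mod_cast (by omega : (j : ℕ) + 1 ≤ 4)
    have hj0 : (0 : ℝ) ≤ ((j : ℕ) : ℝ) := Nat.cast_nonneg _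
    refine ⟨⟨?_, ?_⟩, ?_, ?_⟩ <;> simp only [hp] <;> linarith
  have h1 : ‖trial N p‖ ^ 2 = 0 := hz hpc
  have h2 : trial N p = 0 := by simpa using h1
  unfold trial at h2
  rw [Finset.prod_eq_zero_iff] at h2
  obtain ⟨j, _, h2⟩ := h2
  rw [Finset.prod_eq_zero_iff] at h2
  obtain ⟨k, _, h2⟩ := h2
  split_ifs at h2 with hjk
  · simp at h2
  · have h3 : cutg (p j - p k) = 0 := by exact_mod_cast h2
    unfold cutg at h3
    have hne : ((j : ℕ) : ℤ) - ((k : ℕ) : ℤ) ≠ 0 := by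
      intro h; exact hjk (Fin.ext (by omega))
    have h4 : (1 : ℝ) ≤ (((j : ℕ) : ℝ) - ((k : ℕ) : ℝ)) ^ 2 := by
      have : (1 : ℤ) ≤ (((j : ℕ) : ℤ) - ((k : ℕ) : ℤ)) ^ 2 := by
        have := pow_pos (abs_pos.2 hne) 2
        rw [sq_abs] at this; omega
      exact_mod_cast this
    have h5 : (p j - p k).1 = (((j : ℕ) : ℝ) - ((k : ℕ) : ℝ)) / 6 := by simp [hp]; ring
    refine absurd h3 (Real.smoothTransition.pos_of_pos ?_).ne'
    rw [h5]
    nlinarith [sq_nonneg (p j - p k).2]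

lemma EN_ge {N : ℕ} (hN : N = 3 ∨ N = 4) (α : ℝ) {x0 : ℝ} (hx : x0 ≤ 3 / 20) :
    min (EN 2 α) x0 ≤ EN N α := by
  have hN0 : N ≠ 0 := by omega
  have hpos := trial_pos (N := N) (by omega)
  conv_rhs => unfold EN neumannE
  rw [if_neg hN0]
  refine le_csInf ⟨_, _, admissible_smul (admissible_trial N) (√(normSq N Q0 (trial N)))⁻¹, ?_,
    rfl⟩ ?_
  · rw [normSq_smul, inv_pow, Real.sq_sqrt hpos.le, inv_mul_cancel₀ hpos.ne']
  · rintro E ⟨Ψ, h, hn, rfl⟩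
    by_cases hE : kinE N α Q0 Ψ ≤ 3 / 20
    · exact (min_le_left _ _).trans (final_bound hN α h hn hE)
    · exact (min_le_right _ _).trans (hx.trans (not_le.1 hE).le)

lemma sqrt69_lower : (8.306 : ℝ) ≤ √69 := by
  apply Real.le_sqrt_of_sq_le; norm_num

lemma x0_le : π ^ 2 * (877 - 96 * √69) / 5329 ≤ 3 / 20 := by
  have h1 := sqrt69_lower
  have h2 : π ^ 2 ≤ 3.1416 ^ 2 := by
    have := Real.pi_lt_d4
    have := Real.pi_pos
    gcongr
  have h3 : π ^ 2 * (877 - 96 * √69) ≤ π ^ 2 * (877 - 96 * 8.306) := by gcongr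
  have h4 : π ^ 2 * (877 - 96 * 8.306) ≤ 3.1416 ^ 2 * (877 - 96 * 8.306) := by
    gcongr
  linarith

lemma sqrt_x0 : √(π ^ 2 * (877 - 96 * √69) / 5329) = π * (3 * √69 - 16) / 73 := by
  have h := Real.sq_sqrt (show (0 : ℝ) ≤ 69 by norm_num)
  have h1 := sqrt69_lower
  rw [show π ^ 2 * (877 - 96 * √69) / 5329 = (π * (3 * √69 - 16) / 73) ^ 2 by
    linear_combination (-9 / 5329 * π ^ 2) * h]
  exact Real.sqrt_sq (by have := Real.pi_pos; have : 0 ≤ 3 * √69 - 16 := by linarith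
                         positivity)

/-- Explicit lower bound on the local exclusion constant: for every
`α ∈ [0,1]`, `min{E^N_2(α), E^N_3(α), E^N_4(α)} ≥ min{E^N_2(α), x₀}`, where
`x₀ := π²(877 − 96√69)/5329` is the positive root of `(π + 4√x)² + (9/4)x = (9/4)π²`. -/
theorem exclusion_constant_lower_bound (α : ℝ) (hα : α ∈ Set.Icc (0 : ℝ) 1) :
    (π + 4 * Real.sqrt (π ^ 2 * (877 - 96 * Real.sqrt 69) / 5329)) ^ 2 +
        (9 / 4) * (π ^ 2 * (877 - 96 * Real.sqrt 69) / 5329) = (9 / 4) * π ^ 2 ∧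
      min (EN 2 α) (π ^ 2 * (877 - 96 * Real.sqrt 69) / 5329) ≤
        min (EN 2 α) (min (EN 3 α) (EN 4 α)) := by
  refine ⟨?_, le_min (min_le_left _ _) (le_min (EN_ge (Or.inl rfl) α x0_le)
    (EN_ge (Or.inr rfl) α x0_le))⟩
  rw [sqrt_x0]
  have h := Real.sq_sqrt (show (0 : ℝ) ≤ 69 by norm_num)
  linear_combination (144 / 5329 * π ^ 2) * h
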